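/- arXiv:2104.14946 — 11 statements merged into one kernel-verified Lean document; each statement's English description precedes it below -/
import Mathlib

section
/- Let B be a positive real number. Then the number of triples (z₀,z₁,z₂) of nonzero integers with gcd(z₀,z₁,z₂) = 1, z₀ + z₁ = z₂, |z₀|,|z₁|,|z₂| ≤ B, and z₀, z₁, z₂ all squareful, is exactly 6 times the number of such triples that in addition satisfy z₀, z₁, z₂ > 0. (Both sets are finite.) -/
/-- A nonzero integer `z` is *squareful* if every prime `p` dividing `z`
satisfies `p² ∣ z`. -/
def Squareful (z : ℤ) : Prop :=
  z ≠ 0 ∧ ∀ p : ℕ, p.Prime → (p : ℤ) ∣ z → (p : ℤ) ^ 2 ∣ z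

/-- The set of triples of nonzero squareful integers with `z₀ + z₁ = z₂`,
`gcd(z₀,z₁,z₂) = 1` and all coordinates bounded by `B` in absolute value. -/
def squarefulTriples (B : ℝ) : Set (ℤ × ℤ × ℤ) :=
  {z | z.1 ≠ 0 ∧ z.2.1 ≠ 0 ∧ z.2.2 ≠ 0 ∧
    Int.gcd z.1 (Int.gcd z.2.1 z.2.2) = 1 ∧
    z.1 + z.2.1 = z.2.2 ∧
    |(z.1 : ℝ)| ≤ B ∧ |(z.2.1 : ℝ)| ≤ B ∧ |(z.2.2 : ℝ)| ≤ B ∧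
    Squareful z.1 ∧ Squareful z.2.1 ∧ Squareful z.2.2}

/-- The subset of such triples with all coordinates positive. -/
def squarefulTriplesPos (B : ℝ) : Set (ℤ × ℤ × ℤ) :=
  {z ∈ squarefulTriples B | 0 < z.1 ∧ 0 < z.2.1 ∧ 0 < z.2.2}

theorem squareful_neg {z : ℤ} : Squareful (-z) ↔ Squareful z := by
  simp [Squareful]

theorem finite_squarefulTriples (B : ℝ) : (squarefulTriples B).Finite := by
  have hI := Set.finite_Icc (-⌊B⌋) ⌊B⌋
  refine (hI.prod (hI.prod hI)).subset ?_
  rintro ⟨a, b, c⟩ ⟨-, -, -, -, -, ha, hb, hc, -⟩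
  have key (x : ℤ) (hx : |(x : ℝ)| ≤ B) : x ∈ Set.Icc (-⌊B⌋) ⌊B⌋ := by
    rw [Set.mem_Icc, ← abs_le, Int.le_floor]
    exact_mod_cast hx
  exact ⟨key a ha, key b hb, key c hc⟩

theorem neg_mem_squarefulTriples {B : ℝ} {a b c : ℤ} :
    (-a, -b, -c) ∈ squarefulTriples B ↔ (a, b, c) ∈ squarefulTriples B := by
  have h : -a + -b = -c ↔ a + b = c := by omega
  simp only [squarefulTriples, Set.mem_ofPred_eq, squareful_neg, Int.gcd_neg, Int.neg_gcd,
    Int.cast_neg, abs_neg, neg_ne_zero, h]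

theorem swap_mem_squarefulTriples {B : ℝ} {a b c : ℤ} :
    (b, a, c) ∈ squarefulTriples B ↔ (a, b, c) ∈ squarefulTriples B := by
  have h : b + a = c ↔ a + b = c := by omega
  have hg : Int.gcd b (Int.gcd a c) = Int.gcd a (Int.gcd b c) := by
    rw [← Int.gcd_assoc, ← Int.gcd_assoc, Int.gcd_comm b a]
  simp only [squarefulTriples, Set.mem_ofPred_eq, h, hg]
  tauto

theorem transpose_mem_squarefulTriples {B : ℝ} {a b c : ℤ} :
    (c, -b, a) ∈ squarefulTriples B ↔ (a, b, c) ∈ squarefulTriples B := by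
  have h : c + -b = a ↔ a + b = c := by omega
  have hg : Int.gcd c (Int.gcd b a) = Int.gcd a (Int.gcd b c) := by
    rw [← Int.gcd_assoc, Int.gcd_comm, Int.gcd_comm c b]
  simp only [squarefulTriples, Set.mem_ofPred_eq, squareful_neg, Int.neg_gcd,
    Int.cast_neg, abs_neg, neg_ne_zero, h, hg]
  tauto

theorem ncard_preimage_of_involutive {α : Type*} {f : α → α} (hf : f.Involutive) (s : Set α) :
    (f ⁻¹' s).ncard = s.ncard :=
  Set.ncard_preimage_of_injective_subset_range hf.injective fun x _ => hf.surjective x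

theorem ncard_squarefulTriples_eq_two_mul (B : ℝ) :
    (squarefulTriples B).ncard = 2 * {z ∈ squarefulTriples B | 0 < z.2.2}.ncard := by
  set N := {z ∈ squarefulTriples B | 0 < z.2.2} with hN
  let ν : ℤ × ℤ × ℤ → ℤ × ℤ × ℤ := fun z => (-z.1, -z.2.1, -z.2.2)
  have hν : ν.Involutive := fun z => by simp [ν]
  have hmem (z : ℤ × ℤ × ℤ) : z ∈ ν ⁻¹' N ↔ z ∈ squarefulTriples B ∧ z.2.2 < 0 := by
    simp [ν, hN, neg_mem_squarefulTriples]
  have hfin := finite_squarefulTriples B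
  have hU : squarefulTriples B = N ∪ ν ⁻¹' N := by
    ext z
    rw [Set.mem_union, hmem]
    refine ⟨fun h => ?_, fun h => h.elim And.left And.left⟩
    exact h.2.2.1.lt_or_gt.elim (fun h' => .inr ⟨h, h'⟩) (fun h' => .inl ⟨h, h'⟩)
  have hd : Disjoint N (ν ⁻¹' N) := Set.disjoint_left.2 fun z h h' =>
    lt_asymm h.2 ((hmem z).1 h').2
  rw [hU, Set.ncard_union_eq hd (hfin.subset fun z h => h.1)
    (hfin.subset fun z h => ((hmem z).1 h).1), ncard_preimage_of_involutive hν, two_mul]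

theorem ncard_squarefulTriples_pos_eq_three_mul (B : ℝ) :
    {z ∈ squarefulTriples B | 0 < z.2.2}.ncard = 3 * (squarefulTriplesPos B).ncard := by
  let τ : ℤ × ℤ × ℤ → ℤ × ℤ × ℤ := fun z => (z.2.2, -z.2.1, z.1)
  let ρ : ℤ × ℤ × ℤ → ℤ × ℤ × ℤ := fun z => (-z.1, z.2.2, z.2.1)
  have hτ : τ.Involutive := fun z => by simp [τ]
  have hρ : ρ.Involutive := fun z => by simp [ρ]
  have hmemτ (z : ℤ × ℤ × ℤ) : z ∈ τ ⁻¹' squarefulTriplesPos B ↔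
      z ∈ squarefulTriples B ∧ 0 < z.2.2 ∧ z.2.1 < 0 ∧ 0 < z.1 := by
    simp [τ, squarefulTriplesPos, transpose_mem_squarefulTriples]
    tauto
  have hmemρ (z : ℤ × ℤ × ℤ) : z ∈ ρ ⁻¹' squarefulTriplesPos B ↔
      z ∈ squarefulTriples B ∧ z.1 < 0 ∧ 0 < z.2.2 ∧ 0 < z.2.1 := by
    obtain ⟨a, b, c⟩ := z
    have h : (-a, c, b) ∈ squarefulTriples B ↔ (a, b, c) ∈ squarefulTriples B := by
      rw [swap_mem_squarefulTriples, ← transpose_mem_squarefulTriples, neg_neg,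
        swap_mem_squarefulTriples]
    simp [ρ, squarefulTriplesPos, h]
    tauto
  have hfin := finite_squarefulTriples B
  have hfinP : (squarefulTriplesPos B).Finite := hfin.subset fun z h => h.1
  have hfinτ : (τ ⁻¹' squarefulTriplesPos B).Finite := hfinP.preimage hτ.injective.injOn
  have hfinρ : (ρ ⁻¹' squarefulTriplesPos B).Finite := hfinP.preimage hρ.injective.injOn
  have hU : {z ∈ squarefulTriples B | 0 < z.2.2} =
      squarefulTriplesPos B ∪ τ ⁻¹' squarefulTriplesPos B ∪ ρ ⁻¹' squarefulTriplesPos B := by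
    ext z
    rw [Set.mem_union, Set.mem_union, hmemτ, hmemρ]
    by_cases hz : z ∈ squarefulTriples B
    · obtain ⟨h₀, h₁, -, -, h, -⟩ := id hz
      simp only [squarefulTriplesPos, Set.mem_ofPred_eq, hz, true_and]
      omega
    · simp [squarefulTriplesPos, hz]
  have hd : Disjoint (squarefulTriplesPos B) (τ ⁻¹' squarefulTriplesPos B) :=
    Set.disjoint_left.2 fun z h h' => lt_asymm h.2.2.1 ((hmemτ z).1 h').2.2.1
  have hd' : Disjoint (squarefulTriplesPos B ∪ τ ⁻¹' squarefulTriplesPos B)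
      (ρ ⁻¹' squarefulTriplesPos B) := by
    refine Set.disjoint_left.2 fun z h h' => lt_asymm ((hmemρ z).1 h').2.1 ?_
    exact h.elim (fun h => h.2.1) (fun h => ((hmemτ z).1 h).2.2.2)
  rw [hU, Set.ncard_union_eq hd' (hfinP.union hfinτ) hfinρ, Set.ncard_union_eq hd hfinP hfinτ,
    ncard_preimage_of_involutive hτ, ncard_preimage_of_involutive hρ]
  ring

theorem squarefulTriples_card_eq_six_mul (B : ℝ) (hB : 0 < B) :
    (squarefulTriples B).Finite ∧ (squarefulTriplesPos B).Finite ∧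
      (squarefulTriples B).ncard = 6 * (squarefulTriplesPos B).ncard := by
  have hfin := finite_squarefulTriples B
  refine ⟨hfin, hfin.subset fun z h => h.1, ?_⟩
  rw [ncard_squarefulTriples_eq_two_mul, ncard_squarefulTriples_pos_eq_three_mul]
  ring
end

section
/- The Lebesgue integral over t ∈ ℝ ∖ {0, −1} of the function 1 / ( |t(1+t)|^{1/2} · max(|t|, 1, |1+t|)^{1/2} ) equals 3π. -/
open Real MeasureTheory

/-- The integrand of `σ_∞`. -/
noncomputable def sigmaIntegrand (t : ℝ) : ℝ :=
  1 / (|t * (1 + t)| ^ ((1 : ℝ) / 2) * (max (max |t| 1) |1 + t|) ^ ((1 : ℝ) / 2))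

theorem sigmaIntegrand_neg_one_sub (t : ℝ) : sigmaIntegrand (-1 - t) = sigmaIntegrand t := by
  have h₁ : |-1 - t| = |1 + t| := by rw [← abs_neg]; congr 1; ring
  have h₂ : |1 + (-1 - t)| = |t| := by rw [← abs_neg]; congr 1; ring
  unfold sigmaIntegrand
  rw [abs_mul, abs_mul, h₁, h₂, mul_comm |1 + t|, max_right_comm, max_comm |1 + t| |t|,
    max_right_comm]

theorem sigmaIntegrand_nonneg (t : ℝ) : 0 ≤ sigmaIntegrand t := by
  unfold sigmaIntegrand
  positivity

theorem sigmaIntegrand_of_pos {t : ℝ} (ht : 0 < t) :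
    sigmaIntegrand t = 1 / (√t * (1 + t)) := by
  have h : max (max |t| 1) |1 + t| = 1 + t := by
    rw [abs_of_pos ht, abs_of_pos (by linarith), max_eq_right]
    exact max_le (by linarith) (by linarith)
  unfold sigmaIntegrand
  rw [h, abs_of_pos (by positivity), ← sqrt_eq_rpow, ← sqrt_eq_rpow, sqrt_mul ht.le, mul_assoc,
    mul_self_sqrt (by linarith)]

theorem sigmaIntegrand_of_mem_Ioo {t : ℝ} (ht : t ∈ Set.Ioo (-1 : ℝ) 0) :
    sigmaIntegrand t = 1 / √(-t * (1 + t)) := by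
  obtain ⟨h₁, h₂⟩ := ht
  have h : max (max |t| 1) |1 + t| = 1 := by
    rw [abs_of_neg h₂, abs_of_pos (by linarith), max_eq_right (by linarith : -t ≤ 1),
      max_eq_left (by linarith)]
  unfold sigmaIntegrand
  rw [h, one_rpow, mul_one, ← sqrt_eq_rpow, abs_of_neg (by nlinarith), neg_mul]

theorem hasDerivAt_two_mul_arctan_sqrt {t : ℝ} (ht : 0 < t) :
    HasDerivAt (fun x => 2 * arctan √x) (sigmaIntegrand t) t := by
  refine ((hasDerivAt_sqrt ht.ne').arctan.const_mul 2).congr_deriv ?_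
  rw [sigmaIntegrand_of_pos ht, sq_sqrt ht.le]
  have := sqrt_pos.2 ht
  field_simp

theorem hasDerivAt_arcsin_two_mul_add_one {t : ℝ} (ht : t ∈ Set.Ioo (-1 : ℝ) 0) :
    HasDerivAt (fun x => arcsin (2 * x + 1)) (sigmaIntegrand t) t := by
  obtain ⟨h₁, h₂⟩ := ht
  have hlin : HasDerivAt (fun x : ℝ => 2 * x + 1) 2 t := by
    simpa using ((hasDerivAt_id t).const_mul 2).add_const 1
  refine ((hasDerivAt_arcsin (x := 2 * t + 1) (by linarith) (by linarith)).comp t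
    hlin).congr_deriv ?_
  have h : 1 - (2 * t + 1) ^ 2 = 2 ^ 2 * (-t * (1 + t)) := by ring
  rw [sigmaIntegrand_of_mem_Ioo ⟨h₁, h₂⟩, h, sqrt_mul (by norm_num), sqrt_sq (by norm_num)]
  have : 0 < √(-t * (1 + t)) := sqrt_pos.2 (by nlinarith)
  field_simp

theorem tendsto_two_mul_arctan_sqrt :
    Filter.Tendsto (fun x => 2 * arctan √x) Filter.atTop (nhds π) := by
  have h := (tendsto_nhds_of_tendsto_nhdsWithin tendsto_arctan_atTop).comp tendsto_sqrt_atTop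
  simpa [mul_div_cancel₀, Function.comp_def] using h.const_mul 2

theorem integrableOn_Ioi_sigmaIntegrand : IntegrableOn sigmaIntegrand (Set.Ioi 0) :=
  integrableOn_Ioi_deriv_of_nonneg (by fun_prop)
    (fun _ hx => hasDerivAt_two_mul_arctan_sqrt hx) (fun x _ => sigmaIntegrand_nonneg x)
    tendsto_two_mul_arctan_sqrt

theorem integral_Ioi_sigmaIntegrand : ∫ t in Set.Ioi 0, sigmaIntegrand t = π := by
  rw [integral_Ioi_of_hasDerivAt_of_nonneg (by fun_prop)
    (fun _ hx => hasDerivAt_two_mul_arctan_sqrt hx) (fun x _ => sigmaIntegrand_nonneg x)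
    tendsto_two_mul_arctan_sqrt]
  simp

theorem continuous_arcsin_two_mul_add_one : Continuous fun x => arcsin (2 * x + 1) :=
  continuous_arcsin.comp (by fun_prop)

theorem integrableOn_Ioc_sigmaIntegrand : IntegrableOn sigmaIntegrand (Set.Ioc (-1) 0) :=
  intervalIntegral.integrableOn_deriv_of_nonneg continuous_arcsin_two_mul_add_one.continuousOn
    (fun _ hx => hasDerivAt_arcsin_two_mul_add_one hx) (fun x _ => sigmaIntegrand_nonneg x)

theorem integral_Ioc_sigmaIntegrand : ∫ t in Set.Ioc (-1) 0, sigmaIntegrand t = π := by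
  rw [← intervalIntegral.integral_of_le (by norm_num),
    intervalIntegral.integral_eq_sub_of_hasDerivAt_of_le (by norm_num)
      continuous_arcsin_two_mul_add_one.continuousOn
      (fun _ hx => hasDerivAt_arcsin_two_mul_add_one hx)
      ((intervalIntegrable_iff_integrableOn_Ioc_of_le (by norm_num)).2
        integrableOn_Ioc_sigmaIntegrand)]
  norm_num

theorem preimage_neg_one_sub_Ioi : (fun t : ℝ => -1 - t) ⁻¹' Set.Ioi 0 = Set.Iio (-1) := by
  ext t
  simp only [Set.mem_preimage, Set.mem_Ioi, Set.mem_Iio]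
  constructor <;> intro h <;> linarith

theorem integrableOn_Iic_sigmaIntegrand : IntegrableOn sigmaIntegrand (Set.Iic (-1)) := by
  rw [integrableOn_Iic_iff_integrableOn_Iio, ← preimage_neg_one_sub_Ioi]
  simpa only [Function.comp_def, sigmaIntegrand_neg_one_sub] using
    ((Measure.measurePreserving_sub_left volume (-1 : ℝ)).integrableOn_comp_preimage
      (MeasurableEquiv.subLeft (-1 : ℝ)).measurableEmbedding).2 integrableOn_Ioi_sigmaIntegrand

theorem integral_Iic_sigmaIntegrand : ∫ t in Set.Iic (-1), sigmaIntegrand t = π := by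
  have h := (Measure.measurePreserving_sub_left volume (-1 : ℝ)).setIntegral_preimage_emb
    (MeasurableEquiv.subLeft (-1 : ℝ)).measurableEmbedding sigmaIntegrand (Set.Ioi 0)
  simp only [sigmaIntegrand_neg_one_sub] at h
  rw [integral_Iic_eq_integral_Iio, ← preimage_neg_one_sub_Ioi, h, integral_Ioi_sigmaIntegrand]

/-- The archimedean local density `σ_∞` for the orbifold
`(ℙ¹, ½[0] + ½[1] + ½[∞])` equals `3π`. -/
theorem sigma_infty_eq_three_pi :
    ∫ t in {t : ℝ | t ≠ 0 ∧ t ≠ -1},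
      1 / (|t * (1 + t)| ^ ((1 : ℝ) / 2) * (max (max |t| 1) |1 + t|) ^ ((1 : ℝ) / 2))
      = 3 * π := by
  change ∫ t in {t : ℝ | t ≠ 0 ∧ t ≠ -1}, sigmaIntegrand t = 3 * π
  have hae : ({t : ℝ | t ≠ 0 ∧ t ≠ -1} : Set ℝ) =ᵐ[volume] Set.univ := by
    rw [Filter.eventuallyEq_univ]
    exact (volume.ae_ne 0).and (volume.ae_ne (-1))
  have hunion : Set.Ioc (-1 : ℝ) 0 ∪ Set.Ioi 0 = Set.Ioi (-1) :=
    Set.Ioc_union_Ioi_eq_Ioi (by norm_num)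
  have hint : IntegrableOn sigmaIntegrand (Set.Ioi (-1)) :=
    hunion ▸ integrableOn_Ioc_sigmaIntegrand.union integrableOn_Ioi_sigmaIntegrand
  rw [setIntegral_congr_set hae, ← Set.Iic_union_Ioi (a := (-1 : ℝ)),
    setIntegral_union (Set.Iic_disjoint_Ioi le_rfl) measurableSet_Ioi
      integrableOn_Iic_sigmaIntegrand hint, ← hunion,
    setIntegral_union (Set.Ioc_disjoint_Ioi le_rfl) measurableSet_Ioi
      integrableOn_Ioc_sigmaIntegrand integrableOn_Ioi_sigmaIntegrand,
    integral_Iic_sigmaIntegrand, integral_Ioc_sigmaIntegrand, integral_Ioi_sigmaIntegrand]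
  ring
end

section
/- Let p be a prime and let μ be the additive Haar measure on ℚ_p normalized so that μ(ℤ_p) = 1. Let Ω be the set of t ∈ ℚ_p with t ≠ 0, 1 + t ≠ 0, v_p(t) ∉ {1, −1}, and v_p(1+t) ∉ {1, −1}. Then the integral over Ω of 1 / ( (|t|_p · |1+t|_p)^{1/2} · max(|t|_p, 1, |1+t|_p)^{1/2} ) with respect to μ equals 1 + p^{−1} + 3·p^{−3/2}. -/
open MeasureTheory

section LocalDensity

variable {p : ℕ} [Fact p.Prime]

/-- A closed ball of radius `p ^ (k + 1)` is a union of `p` translates of the ball of radius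
`p ^ k`. -/
lemma Padic.closedBall_eq_biUnion (k : ℤ) :
    {x : ℚ_[p] | ‖x‖ ≤ (p : ℝ) ^ (k + 1)} =
      ⋃ i ∈ Finset.range p, {x : ℚ_[p] | ‖-((i : ℚ_[p]) * (p : ℚ_[p]) ^ (-(k + 1))) + x‖ ≤
        (p : ℝ) ^ k} := by
  have hp : (0 : ℝ) < p := by exact_mod_cast (Fact.out : p.Prime).pos
  have hp' : (p : ℚ_[p]) ≠ 0 := by exact_mod_cast (Fact.out : p.Prime).ne_zero
  have key : ∀ (x : ℚ_[p]) (i : ℕ), -((i : ℚ_[p]) * (p : ℚ_[p]) ^ (-(k + 1))) + x =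
      (x * (p : ℚ_[p]) ^ (k + 1) - i) * (p : ℚ_[p]) ^ (-(k + 1)) := by
    intro x i
    rw [sub_mul, mul_assoc, ← zpow_add₀ hp']
    simp
    ring
  ext x
  simp only [Set.mem_ofPred_eq, Set.mem_iUnion, Finset.mem_range, exists_prop]
  constructor
  · intro hx
    have hy : ‖x * (p : ℚ_[p]) ^ (k + 1)‖ ≤ 1 := by
      rw [norm_mul, Padic.norm_p_zpow, zpow_neg]
      exact mul_inv_le_one_of_le₀ hx (by positivity)
    obtain ⟨y, hxy⟩ : ∃ y : ℤ_[p], (y : ℚ_[p]) = x * (p : ℚ_[p]) ^ (k + 1) := ⟨⟨_, hy⟩, rfl⟩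
    obtain ⟨i, hi, hm⟩ := PadicInt.exists_mem_range y
    refine ⟨i, hi, ?_⟩
    have hlt : ‖x * (p : ℚ_[p]) ^ (k + 1) - i‖ < (p : ℝ) ^ (0 : ℤ) := by
      have h := PadicInt.mem_nonunits.1 ((IsLocalRing.mem_maximalIdeal _).1 hm)
      rw [PadicInt.norm_def, PadicInt.coe_sub, PadicInt.coe_natCast, hxy] at h
      rwa [zpow_zero]
    rw [Padic.norm_lt_pow_iff_norm_le_pow_sub_one] at hlt
    rw [key, norm_mul, Padic.norm_p_zpow]
    calc _ ≤ (p : ℝ) ^ (0 - 1 : ℤ) * (p : ℝ) ^ (-(-(k + 1))) := by gcongr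
      _ = _ := by rw [← zpow_add₀ hp.ne']; congr 1; ring
  · rintro ⟨i, -, hi⟩
    have h1 : x = (i : ℚ_[p]) * (p : ℚ_[p]) ^ (-(k + 1)) +
      (-((i : ℚ_[p]) * (p : ℚ_[p]) ^ (-(k + 1))) + x) := by ring
    rw [h1]
    refine (Padic.nonarchimedean _ _).trans (max_le ?_ (hi.trans ?_))
    · rw [norm_mul, Padic.norm_p_zpow, neg_neg]
      have : ‖(i : ℚ_[p])‖ ≤ 1 := by exact_mod_cast Padic.norm_int_le_one (p := p) i
      exact mul_le_of_le_one_left (by positivity) this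
    · exact zpow_le_zpow_right₀ (by exact_mod_cast (Fact.out : p.Prime).one_le) (by omega)

lemma Padic.pairwiseDisjoint_translates (k : ℤ) :
    (↑(Finset.range p) : Set ℕ).PairwiseDisjoint fun i : ℕ ↦
      {x : ℚ_[p] | ‖-((i : ℚ_[p]) * (p : ℚ_[p]) ^ (-(k + 1))) + x‖ ≤ (p : ℝ) ^ k} := by
  have hp : (0 : ℝ) < p := by exact_mod_cast (Fact.out : p.Prime).pos
  intro i hi j hj hij
  rw [Function.onFun, Set.disjoint_left]
  intro x hx hx'
  simp only [Set.mem_ofPred_eq, Finset.coe_range, Set.mem_Iio] at *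
  have h : ‖(((j : ℤ) - i : ℤ) : ℚ_[p]) * (p : ℚ_[p]) ^ (-(k + 1))‖ ≤ (p : ℝ) ^ k := by
    have e : (((j : ℤ) - i : ℤ) : ℚ_[p]) * (p : ℚ_[p]) ^ (-(k + 1)) =
      (-((i : ℚ_[p]) * (p : ℚ_[p]) ^ (-(k + 1))) + x) +
        -(-((j : ℚ_[p]) * (p : ℚ_[p]) ^ (-(k + 1))) + x) := by push_cast; ring
    rw [e]
    refine (Padic.nonarchimedean _ _).trans (max_le hx ?_)
    rwa [norm_neg]
  have hdvd : ((p : ℤ)) ∣ (j : ℤ) - i := by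
    rw [← Padic.norm_intCast_lt_one_iff]
    by_contra! h1
    rw [norm_mul, Padic.norm_p_zpow, neg_neg] at h
    have : (p : ℝ) ^ k < (p : ℝ) ^ (k + 1) :=
      zpow_lt_zpow_right₀ (by exact_mod_cast (Fact.out : p.Prime).one_lt) (by omega)
    have := le_mul_of_one_le_left (zpow_pos hp (k + 1)).le h1
    linarith
  have := Int.eq_zero_of_abs_lt_dvd hdvd (by rw [abs_lt]; omega)
  omega

lemma Padic.norm_eq_zpow_iff {x : ℚ_[p]} {k : ℤ} :
    ‖x‖ = (p : ℝ) ^ k ↔ x ≠ 0 ∧ x.valuation = -k := by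
  have hp : (1 : ℝ) < p := by exact_mod_cast (Fact.out : p.Prime).one_lt
  constructor
  · intro h
    have hx : x ≠ 0 := by
      rintro rfl
      have : (0 : ℝ) < (p : ℝ) ^ k := by positivity
      simp only [norm_zero] at h
      linarith
    refine ⟨hx, ?_⟩
    rw [Padic.norm_eq_zpow_neg_valuation hx] at h
    have := zpow_right_injective₀ (by linarith) hp.ne' h
    omega
  · rintro ⟨hx, hv⟩
    rw [Padic.norm_eq_zpow_neg_valuation hx, hv, neg_neg]

lemma Padic.norm_one_add_of_ne {t : ℚ_[p]} (h : ‖t‖ ≠ 1) : ‖1 + t‖ = max 1 ‖t‖ := by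
  rw [Padic.add_eq_max_of_ne (by rwa [norm_one, ne_comm]), norm_one]

lemma Padic.norm_of_norm_one_add_ne {t : ℚ_[p]} (h : ‖1 + t‖ ≠ 1) : ‖t‖ = max 1 ‖1 + t‖ := by
  conv_lhs => rw [show t = -1 + (1 + t) by ring]
  rw [Padic.add_eq_max_of_ne (by rwa [norm_neg, norm_one, ne_comm]), norm_neg, norm_one]

variable [MeasurableSpace ℚ_[p]] [BorelSpace ℚ_[p]] (μ : Measure ℚ_[p]) [μ.IsAddHaarMeasure]

lemma Padic.measure_closedBall_succ (k : ℤ) :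
    μ {x : ℚ_[p] | ‖x‖ ≤ (p : ℝ) ^ (k + 1)} = p * μ {x : ℚ_[p] | ‖x‖ ≤ (p : ℝ) ^ k} := by
  rw [Padic.closedBall_eq_biUnion, measure_biUnion_finset (Padic.pairwiseDisjoint_translates k)]
  · have : ∀ i : ℕ, μ {x : ℚ_[p] | ‖-((i : ℚ_[p]) * (p : ℚ_[p]) ^ (-(k + 1))) + x‖ ≤ (p : ℝ) ^ k}
        = μ {x : ℚ_[p] | ‖x‖ ≤ (p : ℝ) ^ k} := fun i ↦
      measure_preimage_add μ (-((i : ℚ_[p]) * (p : ℚ_[p]) ^ (-(k + 1))))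
        {x : ℚ_[p] | ‖x‖ ≤ (p : ℝ) ^ k}
    simp only [this, Finset.sum_const, Finset.card_range, nsmul_eq_mul]
  · intro i _
    exact measurableSet_le (by fun_prop) measurable_const

variable {μ}

lemma Padic.measure_closedBall (hμ : μ {x : ℚ_[p] | ‖x‖ ≤ 1} = 1) (k : ℤ) :
    μ {x : ℚ_[p] | ‖x‖ ≤ (p : ℝ) ^ k} = ENNReal.ofReal ((p : ℝ) ^ k) := by
  have hp : (0 : ℝ) < p := by exact_mod_cast (Fact.out : p.Prime).pos
  have hstep : ∀ k : ℤ, ENNReal.ofReal ((p : ℝ) ^ (k + 1)) = p * ENNReal.ofReal ((p : ℝ) ^ k) := by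
    intro k
    rw [zpow_add_one₀ hp.ne', mul_comm, ENNReal.ofReal_mul hp.le, ENNReal.ofReal_natCast]
  induction k using Int.induction_on with
  | zero => simpa using hμ
  | succ k ih => rw [Padic.measure_closedBall_succ, ih, hstep]
  | pred k ih =>
    have h1 := Padic.measure_closedBall_succ μ (-(k : ℤ) - 1)
    have h2 := hstep (-(k : ℤ) - 1)
    rw [sub_add_cancel] at h1 h2
    rw [ih, h2] at h1
    exact ((ENNReal.mul_right_inj (by exact_mod_cast (Fact.out : p.Prime).ne_zero)
      (ENNReal.natCast_ne_top p)).1 h1).symm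

lemma Padic.measure_ball (hμ : μ {x : ℚ_[p] | ‖x‖ ≤ 1} = 1) (k : ℤ) :
    μ {x : ℚ_[p] | ‖x‖ < (p : ℝ) ^ k} = ENNReal.ofReal ((p : ℝ) ^ (k - 1)) := by
  simp_rw [Padic.norm_lt_pow_iff_norm_le_pow_sub_one]
  exact Padic.measure_closedBall hμ _

lemma Padic.measure_sphere (hμ : μ {x : ℚ_[p] | ‖x‖ ≤ 1} = 1) (k : ℤ) :
    μ {x : ℚ_[p] | ‖x‖ = (p : ℝ) ^ k} = ENNReal.ofReal ((p : ℝ) ^ k * (1 - (p : ℝ)⁻¹)) := by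
  have hp : (0 : ℝ) < p := by exact_mod_cast (Fact.out : p.Prime).pos
  have e : {x : ℚ_[p] | ‖x‖ = (p : ℝ) ^ k} =
      {x : ℚ_[p] | ‖x‖ ≤ (p : ℝ) ^ k} \ {x : ℚ_[p] | ‖x‖ < (p : ℝ) ^ k} := by
    ext x
    simp [le_antisymm_iff]
  rw [e, measure_sdiff (Set.ofPred_subset_ofPred.2 fun x hx ↦ le_of_lt hx)
    (measurableSet_lt (by fun_prop) measurable_const).nullMeasurableSet
    (by rw [Padic.measure_ball hμ]; exact ENNReal.ofReal_ne_top),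
    Padic.measure_ball hμ, Padic.measure_closedBall hμ,
    ← ENNReal.ofReal_sub _ (by positivity), zpow_sub_one₀ hp.ne', mul_sub, mul_one]

lemma Padic.measure_unit_one_add_unit (hμ : μ {x : ℚ_[p] | ‖x‖ ≤ 1} = 1) :
    μ {t : ℚ_[p] | ‖t‖ = 1 ∧ ‖1 + t‖ = 1} = ENNReal.ofReal (1 - 2 * (p : ℝ)⁻¹) := by
  have hp : (0 : ℝ) < p := by exact_mod_cast (Fact.out : p.Prime).pos
  have hb : μ {x : ℚ_[p] | ‖x‖ < 1} = ENNReal.ofReal ((p : ℝ)⁻¹) := by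
    simpa using Padic.measure_ball hμ 0
  have hs : μ {x : ℚ_[p] | ‖x‖ = 1} = ENNReal.ofReal (1 - (p : ℝ)⁻¹) := by
    simpa using Padic.measure_sphere hμ 0
  have hb' : μ {x : ℚ_[p] | ‖1 + x‖ < 1} = ENNReal.ofReal ((p : ℝ)⁻¹) :=
    (measure_preimage_add μ 1 {x : ℚ_[p] | ‖x‖ < 1}).trans hb
  have e : {t : ℚ_[p] | ‖t‖ = 1 ∧ ‖1 + t‖ = 1} =
      {x : ℚ_[p] | ‖x‖ = 1} \ {x : ℚ_[p] | ‖1 + x‖ < 1} := by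
    ext t
    simp only [Set.mem_ofPred_eq, Set.mem_sdiff, not_lt]
    refine and_congr_right fun h ↦ ⟨fun h' ↦ h'.ge, fun h' ↦ le_antisymm ?_ h'⟩
    simpa [h] using Padic.nonarchimedean 1 t
  rw [e, measure_sdiff _ (measurableSet_lt (by fun_prop) measurable_const).nullMeasurableSet
    (by rw [hb']; exact ENNReal.ofReal_ne_top), hs, hb', ← ENNReal.ofReal_sub _ (by positivity)]
  · congr 1; ring
  · intro t ht
    rw [Set.mem_ofPred_eq] at ht ⊢
    rw [Padic.norm_of_norm_one_add_ne ht.ne, max_eq_left ht.le]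

end LocalDensity

/-- The integral of a function constant on the pieces of a countable partition, when the
contributions of the pieces form a geometric progression. -/
lemma lintegral_iUnion_of_geometric {α : Type*} [MeasurableSpace α] {μ : Measure α}
    {f : α → ℝ} {S : ℕ → Set α} (hS : ∀ n, MeasurableSet (S n))
    (hd : Pairwise (Function.onFun Disjoint S)) {c m : ℕ → ℝ} {a r : ℝ}
    (hc : ∀ n, 0 ≤ c n) (hf : ∀ n, ∀ t ∈ S n, f t = c n)
    (hm : ∀ n, μ (S n) = ENNReal.ofReal (m n)) (hcm : ∀ n, c n * m n = a * r ^ n)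
    (ha : 0 ≤ a) (hr : 0 ≤ r) (hr' : r < 1) :
    ∫⁻ t in ⋃ n, S n, ENNReal.ofReal (f t) ∂μ = ENNReal.ofReal (a / (1 - r)) := by
  have h : ∀ n, ∫⁻ t in S n, ENNReal.ofReal (f t) ∂μ = ENNReal.ofReal (a * r ^ n) := by
    intro n
    rw [setLIntegral_congr_fun (hS n) (g := fun _ ↦ ENNReal.ofReal (c n))
      (fun t ht ↦ by simp only [hf n t ht]), setLIntegral_const, hm,
      ← ENNReal.ofReal_mul (hc n), hcm]
  rw [lintegral_iUnion hS hd]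
  simp_rw [h]
  rw [← ENNReal.ofReal_tsum_of_nonneg (fun n ↦ by positivity)
    ((summable_geometric_of_lt_one hr hr').mul_left a), tsum_mul_left,
    tsum_geometric_of_lt_one hr hr', div_eq_mul_inv]

section LocalDensity

variable {p : ℕ} [Fact p.Prime]

/-- The domain of integration, split according to which of `0`, `-1`, `∞` the point `t` is
`p`-adically close to, if any. -/
lemma Padic.orbifold_domain_eq :
    {t : ℚ_[p] | t ≠ 0 ∧ 1 + t ≠ 0 ∧ t.valuation ≠ 1 ∧ t.valuation ≠ -1 ∧
        (1 + t).valuation ≠ 1 ∧ (1 + t).valuation ≠ -1} =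
      {t : ℚ_[p] | ‖t‖ = 1 ∧ ‖1 + t‖ = 1} ∪
        ((⋃ n : ℕ, {t : ℚ_[p] | ‖t‖ = (p : ℝ) ^ (-(n + 2) : ℤ)}) ∪
        ((⋃ n : ℕ, {t : ℚ_[p] | ‖1 + t‖ = (p : ℝ) ^ (-(n + 2) : ℤ)}) ∪
        (⋃ n : ℕ, {t : ℚ_[p] | ‖t‖ = (p : ℝ) ^ (n + 2 : ℤ)}))) := by
  have hp : (1 : ℝ) < p := by exact_mod_cast (Fact.out : p.Prime).one_lt
  have h1 : ∀ x : ℚ_[p], ‖x‖ = 1 ↔ x ≠ 0 ∧ x.valuation = 0 := fun x ↦ by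
    simpa using Padic.norm_eq_zpow_iff (x := x) (k := 0)
  have hlt : ∀ n : ℕ, (p : ℝ) ^ (-(n + 2) : ℤ) < 1 := fun n ↦
    zpow_lt_one_of_neg₀ hp (by omega)
  have hgt : ∀ n : ℕ, 1 < (p : ℝ) ^ (n + 2 : ℤ) := fun n ↦ one_lt_zpow₀ hp (by omega)
  ext t
  simp only [Set.mem_ofPred_eq, Set.mem_union, Set.mem_iUnion]
  constructor
  · rintro ⟨ht, ht', h⟩
    rcases lt_trichotomy t.valuation 0 with hv | hv | hv
    · refine Or.inr (Or.inr (Or.inr ⟨(-t.valuation - 2).toNat, ?_⟩))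
      rw [Padic.norm_eq_zpow_iff]
      exact ⟨ht, by omega⟩
    · have hn : ‖t‖ = 1 := (h1 t).2 ⟨ht, hv⟩
      have hw : 0 ≤ (1 + t).valuation := by
        rw [← Padic.norm_le_one_iff_val_nonneg]
        simpa [hn] using Padic.nonarchimedean 1 t
      by_cases hw0 : (1 + t).valuation = 0
      · exact Or.inl ⟨hn, (h1 _).2 ⟨ht', hw0⟩⟩
      · refine Or.inr (Or.inr (Or.inl ⟨((1 + t).valuation - 2).toNat, ?_⟩))
        rw [Padic.norm_eq_zpow_iff]
        exact ⟨ht', by omega⟩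
    · refine Or.inr (Or.inl ⟨(t.valuation - 2).toNat, ?_⟩)
      rw [Padic.norm_eq_zpow_iff]
      exact ⟨ht, by omega⟩
  · rintro (⟨h, h'⟩ | ⟨n, h⟩ | ⟨n, h⟩ | ⟨n, h⟩)
    · rw [h1] at h h'
      exact ⟨h.1, h'.1, by omega, by omega, by omega, by omega⟩
    · have h' : ‖1 + t‖ = 1 := by
        rw [Padic.norm_one_add_of_ne (by rw [h]; exact (hlt n).ne), h, max_eq_left (hlt n).le]
      rw [h1] at h'
      rw [Padic.norm_eq_zpow_iff] at h
      exact ⟨h.1, h'.1, by omega, by omega, by omega, by omega⟩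
    · have h' : ‖t‖ = 1 := by
        rw [Padic.norm_of_norm_one_add_ne (by rw [h]; exact (hlt n).ne), h, max_eq_left (hlt n).le]
      rw [h1] at h'
      rw [Padic.norm_eq_zpow_iff] at h
      exact ⟨h'.1, h.1, by omega, by omega, by omega, by omega⟩
    · have h' : ‖1 + t‖ = (p : ℝ) ^ (n + 2 : ℤ) := by
        rw [Padic.norm_one_add_of_ne (by rw [h]; exact (hgt n).ne'), h, max_eq_right (hgt n).le]
      rw [Padic.norm_eq_zpow_iff] at h h'
      exact ⟨h.1, h'.1, by omega, by omega, by omega, by omega⟩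

end LocalDensity

/-- Lemma 3.1: the non-archimedean local density `σ_p` for the orbifold
`(ℙ¹, ½[0] + ½[1] + ½[∞])` equals `1 + p⁻¹ + 3 p^{-3/2}`. -/
theorem sigma_p_eq (p : ℕ) [Fact p.Prime]
    [MeasurableSpace ℚ_[p]] [BorelSpace ℚ_[p]]
    (μ : Measure ℚ_[p]) [μ.IsAddHaarMeasure]
    (hμ : μ {x : ℚ_[p] | ‖x‖ ≤ 1} = 1) :
    ∫ t in {t : ℚ_[p] | t ≠ 0 ∧ 1 + t ≠ 0 ∧
        t.valuation ≠ 1 ∧ t.valuation ≠ -1 ∧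
        (1 + t).valuation ≠ 1 ∧ (1 + t).valuation ≠ -1},
      1 / ((‖t‖ * ‖1 + t‖) ^ ((1 : ℝ) / 2) *
        (max (max ‖t‖ 1) ‖1 + t‖) ^ ((1 : ℝ) / 2)) ∂μ
      = 1 + (p : ℝ)⁻¹ + 3 * (p : ℝ) ^ (-(3 : ℝ) / 2) := by
  have hp : (1 : ℝ) < p := by exact_mod_cast (Fact.out : p.Prime).one_lt
  have hp2 : (2 : ℝ) ≤ p := by exact_mod_cast (Fact.out : p.Prime).two_le
  have hp0 : (0 : ℝ) < p := by linarith
  obtain ⟨q, hq0, hq1, hq2, hq3⟩ : ∃ q : ℝ, 0 < q ∧ q < 1 ∧ (p : ℝ)⁻¹ = q ^ 2 ∧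
      (p : ℝ) ^ (-(3 : ℝ) / 2) = q ^ 3 := by
    refine ⟨(p : ℝ) ^ (-(1 : ℝ) / 2), by positivity,
      Real.rpow_lt_one_of_one_lt_of_neg hp (by norm_num), ?_, ?_⟩
    · rw [← Real.rpow_natCast, ← Real.rpow_mul hp0.le, ← Real.rpow_neg_one]
      norm_num
    · rw [← Real.rpow_natCast, ← Real.rpow_mul hp0.le]
      norm_num
  have hneg : ∀ n : ℕ, (p : ℝ) ^ (-(n + 2) : ℤ) = (q ^ (n + 2)) ^ 2 := by
    intro n
    rw [← inv_zpow', hq2, ← pow_mul, mul_comm, pow_mul]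
    exact_mod_cast rfl
  have hpos : ∀ n : ℕ, (p : ℝ) ^ (n + 2 : ℤ) = ((q ^ (n + 2))⁻¹) ^ 2 := by
    intro n
    rw [inv_pow, ← hneg, ← zpow_neg, neg_neg]
  have hhalf : ∀ x : ℝ, 0 ≤ x → (x ^ 2) ^ ((1 : ℝ) / 2) = x := fun x hx ↦ by
    rw [← Real.sqrt_eq_rpow, Real.sqrt_sq hx]
  have hlt : ∀ n : ℕ, (p : ℝ) ^ (-(n + 2) : ℤ) < 1 := fun n ↦
    zpow_lt_one_of_neg₀ hp (by omega)
  have hgt : ∀ n : ℕ, 1 < (p : ℝ) ^ (n + 2 : ℤ) := fun n ↦ one_lt_zpow₀ hp (by omega)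
  have hB' : ∀ n : ℕ, ∀ t : ℚ_[p], ‖t‖ = (p : ℝ) ^ (-(n + 2) : ℤ) → ‖1 + t‖ = 1 := fun n t h ↦ by
    rw [Padic.norm_one_add_of_ne (by rw [h]; exact (hlt n).ne), h, max_eq_left (hlt n).le]
  have hC' : ∀ n : ℕ, ∀ t : ℚ_[p], ‖1 + t‖ = (p : ℝ) ^ (-(n + 2) : ℤ) → ‖t‖ = 1 := fun n t h ↦ by
    rw [Padic.norm_of_norm_one_add_ne (by rw [h]; exact (hlt n).ne), h, max_eq_left (hlt n).le]
  have hD' : ∀ n : ℕ, ∀ t : ℚ_[p], ‖t‖ = (p : ℝ) ^ (n + 2 : ℤ) →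
      ‖1 + t‖ = (p : ℝ) ^ (n + 2 : ℤ) := fun n t h ↦ by
    rw [Padic.norm_one_add_of_ne (by rw [h]; exact (hgt n).ne'), h, max_eq_right (hgt n).le]
  have hinj : Function.Injective fun k : ℤ ↦ (p : ℝ) ^ k := zpow_right_injective₀ hp0 hp.ne'
  have hdisj : ∀ (g : ℚ_[p] → ℝ) (k : ℕ → ℤ), Function.Injective k →
      Pairwise (Function.onFun Disjoint fun n ↦ {t | g t = (p : ℝ) ^ k n}) := by
    intro g k hk i j hij
    rw [Function.onFun, Set.disjoint_left]
    intro t hi hj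
    exact hij (hk (hinj (hi.symm.trans hj)))
  have hmeas : ∀ k : ℤ, MeasurableSet {t : ℚ_[p] | ‖t‖ = (p : ℝ) ^ k} := fun k ↦
    measurableSet_eq_fun (by fun_prop) measurable_const
  have hmeas' : ∀ k : ℤ, MeasurableSet {t : ℚ_[p] | ‖1 + t‖ = (p : ℝ) ^ k} := fun k ↦
    measurableSet_eq_fun (by fun_prop) measurable_const
  have hval : q ^ 2 * (1 - q ^ 2) / (1 - q) = q ^ 2 + q ^ 3 := by
    have : 1 - q ≠ 0 := by linarith
    field_simp
    ring
  have hq21 : 0 ≤ 1 - q ^ 2 := by nlinarith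
  set f : ℚ_[p] → ℝ := fun t ↦ 1 / ((‖t‖ * ‖1 + t‖) ^ ((1 : ℝ) / 2) *
        (max (max ‖t‖ 1) ‖1 + t‖) ^ ((1 : ℝ) / 2)) with hf
  have hA : ∫⁻ t in {t : ℚ_[p] | ‖t‖ = 1 ∧ ‖1 + t‖ = 1}, ENNReal.ofReal (f t) ∂μ =
      ENNReal.ofReal (1 - 2 * q ^ 2) := by
    have hm : MeasurableSet {t : ℚ_[p] | ‖t‖ = 1 ∧ ‖1 + t‖ = 1} := by
      simpa only [zpow_zero, ← Set.ofPred_and] using (hmeas 0).inter (hmeas' 0)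
    rw [setLIntegral_congr_fun (g := fun _ ↦ 1) hm
      (fun t ht ↦ by simp [hf, ht.1, ht.2]), setLIntegral_const, one_mul,
      Padic.measure_unit_one_add_unit hμ, hq2]
  have hB : ∫⁻ t in ⋃ n : ℕ, {t : ℚ_[p] | ‖t‖ = (p : ℝ) ^ (-(n + 2) : ℤ)},
      ENNReal.ofReal (f t) ∂μ = ENNReal.ofReal (q ^ 2 + q ^ 3) := by
    rw [← hval]
    refine lintegral_iUnion_of_geometric (c := fun n ↦ (q ^ (n + 2))⁻¹)
      (m := fun n ↦ (q ^ (n + 2)) ^ 2 * (1 - q ^ 2)) (fun n ↦ hmeas _)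
      (hdisj _ _ fun i j h ↦ by simpa using h) (fun n ↦ by positivity) ?_ ?_ ?_ (by positivity)
      hq0.le hq1
    · intro n t ht
      have ht : ‖t‖ = (p : ℝ) ^ (-(n + 2) : ℤ) := ht
      simp only [hf]
      rw [hB' n t ht, ht, max_eq_right (hlt n).le, hneg, mul_one, hhalf _ (by positivity)]
      simp
    · intro n
      rw [Padic.measure_sphere hμ, hneg, hq2]
    · intro n
      field_simp
      ring
  have hC : ∫⁻ t in ⋃ n : ℕ, {t : ℚ_[p] | ‖1 + t‖ = (p : ℝ) ^ (-(n + 2) : ℤ)},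
      ENNReal.ofReal (f t) ∂μ = ENNReal.ofReal (q ^ 2 + q ^ 3) := by
    rw [← hval]
    refine lintegral_iUnion_of_geometric (c := fun n ↦ (q ^ (n + 2))⁻¹)
      (m := fun n ↦ (q ^ (n + 2)) ^ 2 * (1 - q ^ 2)) (fun n ↦ hmeas' _)
      (hdisj _ _ fun i j h ↦ by simpa using h) (fun n ↦ by positivity) ?_ ?_ ?_ (by positivity)
      hq0.le hq1
    · intro n t ht
      have ht : ‖1 + t‖ = (p : ℝ) ^ (-(n + 2) : ℤ) := ht
      simp only [hf]
      rw [hC' n t ht, ht, max_self, max_eq_left (hlt n).le, hneg, one_mul, hhalf _ (by positivity)]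
      simp
    · intro n
      refine (measure_preimage_add μ 1 {t : ℚ_[p] | ‖t‖ = (p : ℝ) ^ (-(n + 2) : ℤ)}).trans ?_
      rw [Padic.measure_sphere hμ, hneg, hq2]
    · intro n
      field_simp
      ring
  have hD : ∫⁻ t in ⋃ n : ℕ, {t : ℚ_[p] | ‖t‖ = (p : ℝ) ^ (n + 2 : ℤ)},
      ENNReal.ofReal (f t) ∂μ = ENNReal.ofReal (q ^ 2 + q ^ 3) := by
    rw [← hval]
    refine lintegral_iUnion_of_geometric (c := fun n ↦ (q ^ (n + 2)) ^ 3)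
      (m := fun n ↦ ((q ^ (n + 2))⁻¹) ^ 2 * (1 - q ^ 2)) (fun n ↦ hmeas _)
      (hdisj _ _ fun i j h ↦ by simpa using h) (fun n ↦ by positivity) ?_ ?_ ?_ (by positivity)
      hq0.le hq1
    · intro n t ht
      have ht : ‖t‖ = (p : ℝ) ^ (n + 2 : ℤ) := ht
      simp only [hf]
      rw [hD' n t ht, ht, max_eq_left (hgt n).le, max_self, hpos, ← sq, hhalf _ (by positivity),
        hhalf _ (by positivity)]
      field_simp
    · intro n
      rw [Padic.measure_sphere hμ, hpos, hq2]
    · intro n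
      field_simp
      ring
  have hfm : Measurable f := by fun_prop
  rw [integral_eq_lintegral_of_nonneg_ae (ae_of_all _ fun t ↦ by simp only [hf]; positivity)
    hfm.aestronglyMeasurable, Padic.orbifold_domain_eq,
    lintegral_union ((MeasurableSet.iUnion fun n ↦ hmeas _).union
      ((MeasurableSet.iUnion fun n ↦ hmeas' _).union (MeasurableSet.iUnion fun n ↦ hmeas _))),
    lintegral_union
      ((MeasurableSet.iUnion fun n ↦ hmeas' _).union (MeasurableSet.iUnion fun n ↦ hmeas _)),
    lintegral_union (MeasurableSet.iUnion fun n ↦ hmeas _), hA, hB, hC, hD,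
    ← ENNReal.ofReal_add (by positivity) (by positivity),
    ← ENNReal.ofReal_add (by positivity) (by positivity),
    ← ENNReal.ofReal_add _ (by positivity), ENNReal.toReal_ofReal, hq2, hq3]
  · ring
  · have : 0 < q ^ 3 := by positivity
    nlinarith
  · rw [← hq2]
    have : (p : ℝ)⁻¹ ≤ 2⁻¹ := by gcongr
    linarith
  · rw [Set.disjoint_left]
    simp only [Set.mem_iUnion, Set.mem_ofPred_eq]
    rintro t ⟨n, h⟩ ⟨m, h'⟩
    linarith [hC' n t h, hgt m]
  · rw [Set.disjoint_left]
    simp only [Set.mem_iUnion, Set.mem_ofPred_eq, Set.mem_union]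
    rintro t ⟨n, h⟩ (⟨m, h'⟩ | ⟨m, h'⟩)
    · linarith [hC' m t h', hlt n]
    · linarith [hlt n, hgt m]
  · rw [Set.disjoint_left]
    simp only [Set.mem_iUnion, Set.mem_ofPred_eq, Set.mem_union]
    rintro t ⟨h, h0⟩ (⟨m, h'⟩ | ⟨m, h'⟩ | ⟨m, h'⟩)
    · linarith [hlt m]
    · linarith [hlt m]
    · linarith [hgt m]
end

section
/- Let a and b be positive coprime squarefree integers with a ≡ b ≡ 1 (mod 4), and let p be a prime dividing 2ab. Let μ be the additive Haar measure on ℚ_p normalized so that μ(ℤ_p) = 1, and let Ω_p be the set of z ∈ ℚ_p such that az² + b ≠ 0 and v_p(az² + b) is neither equal to 1 nor equal to a negative odd integer. Then the integral over Ω_p of 1 / ( max(|z|_p, 1) · |az² + b|_p^{1/2} ) with respect to μ equals 1. -/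
open MeasureTheory

namespace Padic

variable {p : ℕ} [Fact p.Prime]

/-- The norm of a nonzero `p`-adic number determines its valuation. -/
lemma valuation_eq_of_norm_eq {w : ℚ_[p]} {n : ℤ} (h : ‖w‖ = (p : ℝ) ^ (-n)) :
    w ≠ 0 ∧ w.valuation = n := by
  have hp : 1 < (p : ℝ) := mod_cast (Fact.out : p.Prime).one_lt
  have hw : w ≠ 0 := by
    rintro rfl
    rw [norm_zero] at h
    exact (zpow_pos (zero_lt_one.trans hp) _).ne h
  refine ⟨hw, ?_⟩
  rw [norm_eq_zpow_neg_valuation hw] at h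
  exact neg_injective (zpow_right_injective₀ (zero_lt_one.trans hp) hp.ne' h)

lemma norm_add_eq_left_of_lt {x y : ℚ_[p]} (h : ‖y‖ < ‖x‖) : ‖x + y‖ = ‖x‖ := by
  rw [IsUltrametricDist.norm_add_eq_max_of_norm_ne_norm h.ne', max_eq_left h.le]

lemma norm_add_eq_right_of_lt {x y : ℚ_[p]} (h : ‖x‖ < ‖y‖) : ‖x + y‖ = ‖y‖ := by
  rw [add_comm, norm_add_eq_left_of_lt h]

lemma norm_lt_one_iff_le_inv {x : ℚ_[p]} : ‖x‖ < 1 ↔ ‖x‖ ≤ (p : ℝ)⁻¹ := by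
  simpa using norm_lt_pow_iff_norm_le_pow_sub_one x 0

lemma exists_nat_norm_sub_lt_one {x : ℚ_[p]} (hx : ‖x‖ ≤ 1) :
    ∃ n < p, ‖x - n‖ < 1 := by
  obtain ⟨n, hn, h⟩ := PadicInt.exists_mem_range (⟨x, hx⟩ : ℤ_[p])
  refine ⟨n, hn, ?_⟩
  rw [IsLocalRing.mem_maximalIdeal, PadicInt.mem_nonunits] at h
  exact h

/-- An integer divisible by `p` but not by `p ^ 2` has norm `p⁻¹`. -/
lemma norm_intCast_eq_inv {k : ℤ} (hk : Squarefree k) (hpk : (p : ℤ) ∣ k) :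
    ‖(k : ℚ_[p])‖ = (p : ℝ)⁻¹ := by
  refine le_antisymm (norm_lt_one_iff_le_inv.1 (norm_intCast_lt_one_iff.2 hpk)) ?_
  by_contra! h
  have h1 := (norm_lt_pow_iff_norm_le_pow_sub_one (k : ℚ_[p]) (-1)).1 (by simpa using h)
  have h2 : ((p ^ 2 : ℕ) : ℤ) ∣ k := (norm_int_le_pow_iff_dvd k 2).1 (by simpa using h1)
  have h3 : (p : ℤ) * p ∣ k := by simpa [sq] using h2
  exact (Nat.prime_iff_prime_int.1 (Fact.out : p.Prime)).not_isUnit (hk _ h3)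

lemma closedBall_zpow_add_one (k : ℤ) :
    Metric.closedBall (0 : ℚ_[p]) ((p : ℝ) ^ (k + 1)) =
      ⋃ n ∈ Finset.range p,
        Metric.closedBall ((n : ℚ_[p]) * (p : ℚ_[p]) ^ (-(k + 1))) ((p : ℝ) ^ k) := by
  have hp0 : (p : ℝ) ≠ 0 := mod_cast (Fact.out : p.Prime).ne_zero
  have hpp : 0 < (p : ℝ) := mod_cast (Fact.out : p.Prime).pos
  have hp0' : (p : ℚ_[p]) ≠ 0 := mod_cast (Fact.out : p.Prime).ne_zero
  have key (x : ℚ_[p]) (n : ℕ) : ‖x - n * (p : ℚ_[p]) ^ (-(k + 1))‖ ≤ (p : ℝ) ^ k ↔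
      ‖x * (p : ℚ_[p]) ^ (k + 1) - n‖ < 1 := by
    rw [show x - n * (p : ℚ_[p]) ^ (-(k + 1)) =
      (x * (p : ℚ_[p]) ^ (k + 1) - n) * (p : ℚ_[p]) ^ (-(k + 1)) by
        rw [sub_mul, mul_assoc, ← zpow_add₀ hp0']; simp, norm_mul, norm_p_zpow, neg_neg,
      norm_lt_one_iff_le_inv, zpow_add_one₀ hp0, mul_comm, mul_assoc,
      mul_le_iff_le_one_right (zpow_pos hpp k), ← le_inv_mul_iff₀ hpp, mul_one]
  have key' (x : ℚ_[p]) : ‖x‖ ≤ (p : ℝ) ^ (k + 1) ↔ ‖x * (p : ℚ_[p]) ^ (k + 1)‖ ≤ 1 := by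
    rw [norm_mul, norm_p_zpow, zpow_neg, ← div_eq_mul_inv, div_le_one (zpow_pos hpp _)]
  ext x
  simp only [mem_closedBall_iff_norm, sub_zero, Set.mem_iUnion, Finset.mem_range, exists_prop,
    key, key']
  refine ⟨exists_nat_norm_sub_lt_one, fun ⟨n, _, h⟩ => ?_⟩
  have := IsUltrametricDist.norm_add_le_max (x * (p : ℚ_[p]) ^ (k + 1) - n) (n : ℚ_[p])
  rw [sub_add_cancel] at this
  exact this.trans (max_le h.le (mod_cast norm_int_le_one (p := p) n))

lemma pairwiseDisjoint_closedBall_zpow (k : ℤ) :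
    (Finset.range p : Set ℕ).PairwiseDisjoint fun n =>
      Metric.closedBall ((n : ℚ_[p]) * (p : ℚ_[p]) ^ (-(k + 1))) ((p : ℝ) ^ k) := by
  have hpp : 0 < (p : ℝ) := mod_cast (Fact.out : p.Prime).pos
  intro m hm n hn hmn
  refine (IsUltrametricDist.closedBall_eq_or_disjoint _ _ _).resolve_left fun h => hmn ?_
  have hmem : (m : ℚ_[p]) * (p : ℚ_[p]) ^ (-(k + 1)) ∈
      Metric.closedBall ((n : ℚ_[p]) * (p : ℚ_[p]) ^ (-(k + 1))) ((p : ℝ) ^ k) :=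
    h ▸ Metric.mem_closedBall_self (zpow_pos hpp k).le
  rw [mem_closedBall_iff_norm, ← sub_mul, norm_mul, norm_p_zpow, neg_neg,
    zpow_add_one₀ hpp.ne', mul_comm, mul_assoc, mul_le_iff_le_one_right (zpow_pos hpp k),
    ← le_inv_mul_iff₀ hpp, mul_one, ← norm_lt_one_iff_le_inv] at hmem
  have hdvd : (p : ℤ) ∣ (m : ℤ) - n := by
    rw [← norm_intCast_lt_one_iff]
    exact_mod_cast hmem
  simp only [Finset.coe_range, Set.mem_Iio] at hm hn
  have h0 := Int.eq_zero_of_abs_lt_dvd hdvd (by rw [abs_lt]; omega)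
  omega

lemma sphere_zpow (k : ℤ) : Metric.sphere (0 : ℚ_[p]) ((p : ℝ) ^ k) =
    Metric.closedBall 0 ((p : ℝ) ^ k) \ Metric.closedBall 0 ((p : ℝ) ^ (k - 1)) := by
  ext x
  simp [← norm_lt_pow_iff_norm_le_pow_sub_one, le_antisymm_iff]

lemma setOf_one_lt_norm : {z : ℚ_[p] | 1 < ‖z‖} =
    ⋃ k : ℕ, Metric.sphere 0 ((p : ℝ) ^ ((k : ℤ) + 1)) := by
  have hp : 1 < (p : ℝ) := mod_cast (Fact.out : p.Prime).one_lt
  ext z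
  simp only [Set.mem_ofPred_eq, Set.mem_iUnion, mem_sphere_zero_iff_norm]
  constructor
  · intro h
    have hz : z ≠ 0 := norm_pos_iff.1 (zero_lt_one.trans h)
    rw [norm_eq_zpow_neg_valuation hz] at h ⊢
    have hv := (one_lt_zpow_iff_right₀ hp).1 h
    exact ⟨(-z.valuation - 1).toNat, by congr 1; omega⟩
  · rintro ⟨k, hk⟩
    rw [hk]
    exact one_lt_zpow₀ hp (by omega)

section Haar

variable [MeasurableSpace ℚ_[p]] [BorelSpace ℚ_[p]] (μ : Measure ℚ_[p]) [μ.IsAddHaarMeasure]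

lemma measureReal_closedBall_zpow_add_one (k : ℤ) :
    μ.real (Metric.closedBall 0 ((p : ℝ) ^ (k + 1))) =
      p * μ.real (Metric.closedBall 0 ((p : ℝ) ^ k)) := by
  rw [closedBall_zpow_add_one, measureReal_biUnion_finset (pairwiseDisjoint_closedBall_zpow k)
    (fun _ _ => Metric.isClosed_closedBall.measurableSet)
    (fun _ _ => (isCompact_closedBall _ _).measure_lt_top.ne)]
  have (x : ℚ_[p]) (r : ℝ) :
      μ.real (Metric.closedBall x r) = μ.real (Metric.closedBall 0 r) := by
    simp [Measure.real, Measure.addHaar_closedBall_center]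
  simp [this]

variable {μ}

lemma measureReal_closedBall_zpow (hμ : μ (Metric.closedBall 0 1) = 1) (k : ℤ) :
    μ.real (Metric.closedBall 0 ((p : ℝ) ^ k)) = (p : ℝ) ^ k := by
  have hp0 : (p : ℝ) ≠ 0 := mod_cast (Fact.out : p.Prime).ne_zero
  induction k using Int.induction_on with
  | zero => simp [Measure.real, hμ]
  | succ k ih => rw [measureReal_closedBall_zpow_add_one, ih, zpow_add_one₀ hp0, mul_comm]
  | pred k ih =>
    have := measureReal_closedBall_zpow_add_one μ (-(k : ℤ) - 1)
    rw [sub_add_cancel, ih] at this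
    rw [← mul_right_inj' hp0, ← this,
      ← zpow_one_add₀ hp0, add_sub_cancel]

lemma measureReal_sphere_zpow (hμ : μ (Metric.closedBall 0 1) = 1) (k : ℤ) :
    μ.real (Metric.sphere 0 ((p : ℝ) ^ k)) = (p : ℝ) ^ k * (1 - (p : ℝ)⁻¹) := by
  have hp : 1 < (p : ℝ) := mod_cast (Fact.out : p.Prime).one_lt
  rw [sphere_zpow, measureReal_sdiff (Metric.closedBall_subset_closedBall
      (zpow_le_zpow_right₀ hp.le (sub_one_lt k).le)) Metric.isClosed_closedBall.measurableSet
      (isCompact_closedBall _ _).measure_lt_top.ne,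
    measureReal_closedBall_zpow hμ, measureReal_closedBall_zpow hμ,
    zpow_sub_one₀ (zero_lt_one.trans hp).ne']
  ring

/-- The integral of `‖z‖⁻²` over the complement of the unit ball. -/
lemma integral_one_lt_norm (hμ : μ (Metric.closedBall 0 1) = 1) :
    IntegrableOn (fun z : ℚ_[p] => 1 / ‖z‖ ^ 2) {z | 1 < ‖z‖} μ ∧
      ∫ z in {z : ℚ_[p] | 1 < ‖z‖}, 1 / ‖z‖ ^ 2 ∂μ = (p : ℝ)⁻¹ := by
  have hp : 1 < (p : ℝ) := mod_cast (Fact.out : p.Prime).one_lt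
  have hp0 : (p : ℝ) ≠ 0 := (zero_lt_one.trans hp).ne'
  have hm (k : ℕ) : MeasurableSet (Metric.sphere (0 : ℚ_[p]) ((p : ℝ) ^ ((k : ℤ) + 1))) :=
    Metric.isClosed_sphere.measurableSet
  have hd : Pairwise (Function.onFun Disjoint
      fun k : ℕ => Metric.sphere (0 : ℚ_[p]) ((p : ℝ) ^ ((k : ℤ) + 1))) := by
    intro i j hij
    refine Set.disjoint_left.2 fun z hi hj => hij ?_
    rw [mem_sphere_zero_iff_norm] at hi hj
    have := zpow_right_injective₀ (zero_lt_one.trans hp) hp.ne' (hi.symm.trans hj)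
    omega
  have hcongr (k : ℕ) : Set.EqOn (fun z : ℚ_[p] => 1 / ‖z‖ ^ 2)
      (fun _ => 1 / ((p : ℝ) ^ ((k : ℤ) + 1)) ^ 2)
      (Metric.sphere (0 : ℚ_[p]) ((p : ℝ) ^ ((k : ℤ) + 1))) := by
    intro z hz
    rw [mem_sphere_zero_iff_norm] at hz
    simp only [hz]
  have hint (k : ℕ) : IntegrableOn (fun z : ℚ_[p] => 1 / ‖z‖ ^ 2)
      (Metric.sphere (0 : ℚ_[p]) ((p : ℝ) ^ ((k : ℤ) + 1))) μ :=
    (integrableOn_congr_fun (hcongr k) (hm k)).2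
      (integrableOn_const (isCompact_sphere _ _).measure_lt_top.ne)
  have hval (k : ℕ) : ∫ z in Metric.sphere (0 : ℚ_[p]) ((p : ℝ) ^ ((k : ℤ) + 1)), 1 / ‖z‖ ^ 2 ∂μ =
      (1 - (p : ℝ)⁻¹) * (p : ℝ)⁻¹ * ((p : ℝ)⁻¹) ^ k := by
    rw [setIntegral_congr_fun (hm k) (hcongr k), setIntegral_const, measureReal_sphere_zpow hμ,
      zpow_add_one₀ hp0, zpow_natCast, smul_eq_mul, inv_pow]
    field_simp
  have hsum : HasSum (fun k : ℕ => (1 - (p : ℝ)⁻¹) * (p : ℝ)⁻¹ * ((p : ℝ)⁻¹) ^ k) (p : ℝ)⁻¹ := by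
    have h1 : (p : ℝ)⁻¹ < 1 := inv_lt_one_of_one_lt₀ hp
    have h := (hasSum_geometric_of_lt_one (by positivity) h1).mul_left
      ((1 - (p : ℝ)⁻¹) * (p : ℝ)⁻¹)
    rwa [mul_right_comm, mul_inv_cancel₀ (sub_pos.2 h1).ne', one_mul] at h
  have hon : IntegrableOn (fun z : ℚ_[p] => 1 / ‖z‖ ^ 2) {z | 1 < ‖z‖} μ := by
    rw [setOf_one_lt_norm]
    refine integrableOn_iUnion_of_summable_integral_norm hint ?_
    simp only [norm_div, norm_one, norm_pow, norm_norm, hval]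
    exact hsum.summable
  refine ⟨hon, ?_⟩
  rw [setOf_one_lt_norm] at hon ⊢
  rw [integral_iUnion hm hd hon]
  simp only [hval]
  exact hsum.tsum_eq

omit [BorelSpace ℚ_[p]] in
lemma setIntegral_of_norm_eq_one {F : ℚ_[p] → ℚ_[p]} {A : Set ℚ_[p]} (hA : MeasurableSet A)
    (hA1 : A ⊆ Metric.closedBall 0 1) (hF : ∀ z ∈ A, ‖F z‖ = 1) :
    IntegrableOn (fun z => 1 / (max ‖z‖ 1 * ‖F z‖ ^ ((1 : ℝ) / 2))) A μ ∧
      ∫ z in A, 1 / (max ‖z‖ 1 * ‖F z‖ ^ ((1 : ℝ) / 2)) ∂μ = μ.real A := by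
  have hcongr : Set.EqOn (fun z => 1 / (max ‖z‖ 1 * ‖F z‖ ^ ((1 : ℝ) / 2))) (fun _ => 1) A := by
    intro z hz
    simp [hF z hz, max_eq_right (mem_closedBall_zero_iff.1 (hA1 hz))]
  refine ⟨(integrableOn_congr_fun hcongr hA).2 (integrableOn_const
    ((measure_mono hA1).trans_lt (isCompact_closedBall _ _).measure_lt_top).ne), ?_⟩
  rw [setIntegral_congr_fun hA hcongr]
  simp

lemma setIntegral_union_one_lt_norm (hμ : μ (Metric.closedBall 0 1) = 1)
    {F : ℚ_[p] → ℚ_[p]} {A : Set ℚ_[p]} (hA : MeasurableSet A)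
    (hA1 : A ⊆ Metric.closedBall 0 1) (hF : ∀ z ∈ A, ‖F z‖ = 1)
    (hF' : ∀ z, 1 < ‖z‖ → ‖F z‖ = ‖z‖ ^ 2) :
    ∫ z in A ∪ {z | 1 < ‖z‖}, 1 / (max ‖z‖ 1 * ‖F z‖ ^ ((1 : ℝ) / 2)) ∂μ =
      μ.real A + (p : ℝ)⁻¹ := by
  obtain ⟨hi, hv⟩ := setIntegral_of_norm_eq_one (μ := μ) hA hA1 hF
  obtain ⟨hi', hv'⟩ := integral_one_lt_norm hμ
  have hm : MeasurableSet {z : ℚ_[p] | 1 < ‖z‖} :=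
    (isOpen_lt continuous_const continuous_norm).measurableSet
  have hcongr : Set.EqOn (fun z => 1 / (max ‖z‖ 1 * ‖F z‖ ^ ((1 : ℝ) / 2)))
      (fun z => 1 / ‖z‖ ^ 2) {z | 1 < ‖z‖} := by
    intro z hz
    simp only
    rw [hF' z hz, max_eq_left (le_of_lt hz), ← Real.sqrt_eq_rpow,
      Real.sqrt_sq (norm_nonneg z), sq]
  rw [setIntegral_union _ hm hi ((integrableOn_congr_fun hcongr hm).2 hi'), hv,
    setIntegral_congr_fun hm hcongr, hv']
  exact Set.disjoint_left.2 fun z hz hz' =>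
    (mem_closedBall_zero_iff.1 (hA1 hz)).not_gt hz'

end Haar

end Padic

section BinaryForm

variable {p : ℕ} [Fact p.Prime] {a b z : ℚ_[p]}

namespace Padic

lemma valuation_of_norm_eq_one {w : ℚ_[p]} (h : ‖w‖ = 1) : w ≠ 0 ∧ w.valuation = 0 :=
  valuation_eq_of_norm_eq (by simpa using h)

lemma norm_form_of_one_lt (ha : ‖a‖ = 1) (hb : ‖b‖ ≤ 1) (hz : 1 < ‖z‖) :
    ‖a * z ^ 2 + b‖ = ‖z‖ ^ 2 := by
  have h : ‖a * z ^ 2‖ = ‖z‖ ^ 2 := by simp [ha]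
  rw [norm_add_eq_left_of_lt, h]
  rw [h]
  nlinarith

lemma valuation_form_of_one_lt (ha : ‖a‖ = 1) (hb : ‖b‖ ≤ 1) (hz : 1 < ‖z‖) :
    a * z ^ 2 + b ≠ 0 ∧ (a * z ^ 2 + b).valuation = 2 * z.valuation := by
  apply valuation_eq_of_norm_eq
  rw [norm_form_of_one_lt ha hb hz,
    norm_eq_zpow_neg_valuation (norm_pos_iff.1 (zero_lt_one.trans hz)), ← zpow_natCast,
    ← zpow_mul]
  congr 1
  push_cast
  ring

lemma valuation_form_of_one_lt_of_norm_eq_inv (ha : ‖a‖ = (p : ℝ)⁻¹) (hb : ‖b‖ ≤ 1)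
    (hz : 1 < ‖z‖) : z.valuation < 0 ∧ (a * z ^ 2 + b).valuation = 1 + 2 * z.valuation := by
  have hp : 1 < (p : ℝ) := mod_cast (Fact.out : p.Prime).one_lt
  have hnorm := norm_eq_zpow_neg_valuation (norm_pos_iff.1 (zero_lt_one.trans hz))
  have hv : z.valuation < 0 := by
    rw [hnorm, one_lt_zpow_iff_right₀ hp] at hz
    omega
  have h : ‖a * z ^ 2‖ = (p : ℝ) ^ (-(1 + 2 * z.valuation)) := by
    rw [norm_mul, norm_pow, ha, hnorm, ← zpow_natCast, ← zpow_mul, ← zpow_neg_one,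
      ← zpow_add₀ (zero_lt_one.trans hp).ne']
    congr 1
    push_cast
    ring
  refine ⟨hv, (valuation_eq_of_norm_eq ?_).2⟩
  rw [norm_add_eq_left_of_lt, h]
  rw [h]
  exact hb.trans_lt (one_lt_zpow₀ hp (by omega))

lemma norm_form_of_lt_one (ha : ‖a‖ ≤ 1) (hb : ‖b‖ = 1) (hz : ‖z‖ < 1) :
    ‖a * z ^ 2 + b‖ = 1 := by
  rw [norm_add_eq_right_of_lt, hb]
  rw [hb, norm_mul, norm_pow]
  exact mul_lt_one_of_nonneg_of_lt_one_right ha (by positivity)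
    (pow_lt_one₀ (norm_nonneg z) hz two_ne_zero)

lemma valuation_form_of_lt_one_of_norm_eq_inv (ha : ‖a‖ ≤ 1) (hb : ‖b‖ = (p : ℝ)⁻¹)
    (hz : ‖z‖ < 1) : (a * z ^ 2 + b).valuation = 1 := by
  have hp : 1 < (p : ℝ) := mod_cast (Fact.out : p.Prime).one_lt
  refine (valuation_eq_of_norm_eq ?_).2
  rw [norm_add_eq_right_of_lt, hb, zpow_neg_one]
  have h1 := norm_lt_one_iff_le_inv.1 hz
  calc ‖a * z ^ 2‖ = ‖a‖ * ‖z‖ ^ 2 := by simp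
    _ ≤ 1 * (p : ℝ)⁻¹ ^ 2 := by gcongr
    _ < ‖b‖ := by
      rw [hb, one_mul]
      exact pow_lt_self_of_lt_one₀ (by positivity) (inv_lt_one_of_one_lt₀ hp) one_lt_two

/-- If `a ≡ b ≡ 1 (mod 4)`, the form `a z² + b` has valuation `1` on `2`-adic units. -/
lemma valuation_form_two {a b : ℤ} (ha : a % 4 = 1) (hb : b % 4 = 1) {z : ℚ_[2]}
    (hz : ‖z‖ = 1) : ((a : ℚ_[2]) * z ^ 2 + b).valuation = 1 := by
  obtain ⟨n, hn, h⟩ := exists_nat_norm_sub_lt_one hz.le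
  have hn1 : n = 1 := by
    have : n ≠ 0 := by
      rintro rfl
      simp [hz] at h
    omega
  subst hn1
  set t := (z - 1) / 2 with ht
  have h2 : ‖(2 : ℚ_[2])‖ = 2⁻¹ := by simpa using norm_p (p := 2)
  have ht1 : ‖t‖ ≤ 1 := by
    have := norm_lt_one_iff_le_inv.1 h
    rw [ht, norm_div, h2]
    push_cast at this
    exact (div_le_one (by norm_num)).2 this
  obtain ⟨m, hm⟩ : ∃ m, a + b = 4 * m + 2 := ⟨(a + b) / 4, by omega⟩
  have hm' : (a : ℚ_[2]) + b = 4 * m + 2 := mod_cast hm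
  have hform : (a : ℚ_[2]) * z ^ 2 + b = 2 * (2 * (m + a * t * (1 + t)) + 1) := by
    rw [show z = 1 + 2 * t by rw [ht]; ring]
    linear_combination hm'
  have hle : ‖(m : ℚ_[2]) + a * t * (1 + t)‖ ≤ 1 := by
    let T : ℤ_[2] := ⟨t, ht1⟩
    exact ((m : ℤ_[2]) + a * T * (1 + T)).2
  refine (valuation_eq_of_norm_eq ?_).2
  rw [hform, norm_mul, norm_add_eq_right_of_lt, norm_one, h2]
  · norm_num
  · rw [norm_mul, h2, norm_one]
    linarith

end Padic

end BinaryForm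

open Padic in
/-- Lemma 6.2, the case `p ∣ 2ab`: the non-archimedean local density for the
orbifold `(ℙ¹, ½V(ax² + by²))` equals `1`. -/
theorem sigma_p_binary_form_bad_prime (a b : ℤ) (ha : 0 < a) (hb : 0 < b)
    (hab : IsCoprime a b) (hsa : Squarefree a) (hsb : Squarefree b)
    (ha4 : a % 4 = 1) (hb4 : b % 4 = 1)
    (p : ℕ) [Fact p.Prime] (hpab : (p : ℤ) ∣ 2 * a * b)
    [MeasurableSpace ℚ_[p]] [BorelSpace ℚ_[p]]
    (μ : Measure ℚ_[p]) [μ.IsAddHaarMeasure]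
    (hμ : μ {x : ℚ_[p] | ‖x‖ ≤ 1} = 1) :
    ∫ z in {z : ℚ_[p] | (a : ℚ_[p]) * z ^ 2 + (b : ℚ_[p]) ≠ 0 ∧
        ((a : ℚ_[p]) * z ^ 2 + (b : ℚ_[p])).valuation ≠ 1 ∧
        ¬(((a : ℚ_[p]) * z ^ 2 + (b : ℚ_[p])).valuation < 0 ∧
          Odd (((a : ℚ_[p]) * z ^ 2 + (b : ℚ_[p])).valuation))},
      1 / (max ‖z‖ 1 * ‖(a : ℚ_[p]) * z ^ 2 + (b : ℚ_[p])‖ ^ ((1 : ℝ) / 2)) ∂μ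
      = 1 := by
  have hpp : Prime (p : ℤ) := Nat.prime_iff_prime_int.1 (Fact.out : p.Prime)
  have hball : {x : ℚ_[p] | ‖x‖ ≤ 1} = Metric.closedBall 0 1 := by
    ext
    simp
  rw [hball] at hμ
  have norm_unit {k : ℤ} (hk : ¬(p : ℤ) ∣ k) : ‖(k : ℚ_[p])‖ = 1 :=
    (norm_int_le_one k).antisymm (not_lt.1 (mt norm_intCast_lt_one_iff.1 hk))
  by_cases hpa : (p : ℤ) ∣ a
  · have hb1 : ‖(b : ℚ_[p])‖ = 1 :=
      norm_unit fun h => hpp.not_isUnit (hab.isUnit_of_dvd' hpa h)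
    have ha1 := norm_intCast_eq_inv hsa hpa
    have hF : ∀ z ∈ Metric.closedBall (0 : ℚ_[p]) 1, ‖(a : ℚ_[p]) * z ^ 2 + b‖ = 1 := by
      intro z hz
      rw [mem_closedBall_zero_iff] at hz
      rw [norm_add_eq_right_of_lt, hb1]
      rw [hb1, norm_mul, norm_pow]
      exact mul_lt_one_of_nonneg_of_lt_one_left (norm_nonneg _)
        (norm_intCast_lt_one_iff.2 hpa) (pow_le_one₀ (norm_nonneg z) hz)
    convert (setIntegral_of_norm_eq_one (μ := μ) Metric.isClosed_closedBall.measurableSet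
      subset_rfl hF).2 using 2
    · congr 1
      ext z
      simp only [Set.mem_ofPred_eq]
      refine ⟨fun ⟨_, _, h⟩ => ?_, fun h => ?_⟩
      · rw [mem_closedBall_zero_iff]
        by_contra! hz
        obtain ⟨hv, hv'⟩ := valuation_form_of_one_lt_of_norm_eq_inv ha1 hb1.le hz
        exact h ⟨by omega, by rw [hv']; exact ⟨z.valuation, add_comm _ _⟩⟩
      · obtain ⟨h0, hv⟩ := valuation_of_norm_eq_one (hF z h)
        simp [h0, hv]
    · simp [Measure.real, hμ]
  have ha1 := norm_unit hpa
  have hout (z : ℚ_[p]) (hz : 1 < ‖z‖) := norm_form_of_one_lt ha1 (norm_int_le_one b) hz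
  have hset {A : Set ℚ_[p]} (hA1 : A ⊆ Metric.closedBall 0 1)
      (hF : ∀ z ∈ A, ‖(a : ℚ_[p]) * z ^ 2 + b‖ = 1)
      (hF' : ∀ z ∈ Metric.closedBall 0 1, z ∉ A → ((a : ℚ_[p]) * z ^ 2 + b).valuation = 1) :
      {z : ℚ_[p] | (a : ℚ_[p]) * z ^ 2 + (b : ℚ_[p]) ≠ 0 ∧
        ((a : ℚ_[p]) * z ^ 2 + (b : ℚ_[p])).valuation ≠ 1 ∧
        ¬(((a : ℚ_[p]) * z ^ 2 + (b : ℚ_[p])).valuation < 0 ∧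
          Odd (((a : ℚ_[p]) * z ^ 2 + (b : ℚ_[p])).valuation))} = A ∪ {z | 1 < ‖z‖} := by
    ext z
    simp only [Set.mem_ofPred_eq, Set.mem_union]
    refine ⟨fun ⟨_, h, _⟩ => ?_, ?_⟩
    · by_contra! hz
      exact h (hF' z (mem_closedBall_zero_iff.2 hz.2) hz.1)
    · rintro (hz | hz)
      · obtain ⟨h0, hv⟩ := valuation_of_norm_eq_one (hF z hz)
        simp [h0, hv]
      · obtain ⟨h0, hv⟩ := valuation_form_of_one_lt ha1 (norm_int_le_one b) hz
        rw [hv]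
        exact ⟨h0, by omega, fun h => Int.not_odd_iff_even.2 (even_two_mul _) h.2⟩
  rcases eq_or_ne p 2 with rfl | hp2
  · have hb1 : ‖(b : ℚ_[2])‖ = 1 := norm_unit (by omega)
    have hA1 : Metric.closedBall (0 : ℚ_[2]) ((2 : ℕ) ^ (-1 : ℤ)) ⊆ Metric.closedBall 0 1 :=
      Metric.closedBall_subset_closedBall (by norm_num)
    have hmem (z : ℚ_[2]) : z ∈ Metric.closedBall (0 : ℚ_[2]) ((2 : ℕ) ^ (-1 : ℤ)) ↔ ‖z‖ < 1 := by
      rw [mem_closedBall_zero_iff, norm_lt_one_iff_le_inv, zpow_neg_one]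
    have hF (z) (hz : z ∈ Metric.closedBall (0 : ℚ_[2]) ((2 : ℕ) ^ (-1 : ℤ))) :=
      norm_form_of_lt_one ha1.le hb1 ((hmem z).1 hz)
    rw [hset hA1 hF fun z hz hz' => valuation_form_two ha4 hb4
        ((mem_closedBall_zero_iff.1 hz).antisymm (not_lt.1 (mt (hmem z).2 hz'))),
      setIntegral_union_one_lt_norm hμ Metric.isClosed_closedBall.measurableSet hA1 hF hout,
      measureReal_closedBall_zpow hμ]
    norm_num
  · have hpb : (p : ℤ) ∣ b := by
      refine (hpp.dvd_or_dvd hpab).resolve_left fun h =>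
        (hpp.dvd_or_dvd h).elim (fun h2 => hp2 ?_) hpa
      exact (Nat.prime_dvd_prime_iff_eq Fact.out Nat.prime_two).1 (mod_cast h2)
    have hb1 := norm_intCast_eq_inv hsb hpb
    have hA1 : Metric.sphere (0 : ℚ_[p]) ((p : ℝ) ^ (0 : ℤ)) ⊆ Metric.closedBall 0 1 := by
      simpa using Metric.sphere_subset_closedBall
    have hF (z) (hz : z ∈ Metric.sphere (0 : ℚ_[p]) ((p : ℝ) ^ (0 : ℤ))) :
        ‖(a : ℚ_[p]) * z ^ 2 + b‖ = 1 := by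
      have hz1 : ‖(a : ℚ_[p]) * z ^ 2‖ = 1 := by
        simp_all
      rw [norm_add_eq_left_of_lt, hz1]
      rw [hz1]
      exact norm_intCast_lt_one_iff.2 hpb
    rw [hset hA1 hF fun z hz hz' => valuation_form_of_lt_one_of_norm_eq_inv ha1.le hb1
        ((mem_closedBall_zero_iff.1 hz).lt_of_ne (by simpa using hz')),
      setIntegral_union_one_lt_norm hμ Metric.isClosed_sphere.measurableSet hA1 hF hout,
      measureReal_sphere_zpow hμ]
    simp
end

section
/- Let a and b be positive real numbers. Then the Lebesgue integral over z ∈ ℝ of 1 / ( max(|z|, 1) · (az² + b)^{1/2} ) equals 2·( arsinh(√(a/b))/√a + arsinh(√(b/a))/√b ). -/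
open Real MeasureTheory

open Set Filter Topology

theorem hasDerivAt_arsinh_mul_div {p q : ℝ} (hp : 0 < p) (hq : 0 < q) (z : ℝ) :
    HasDerivAt (fun z ↦ arsinh (p / q * z) / p) (1 / √(p ^ 2 * z ^ 2 + q ^ 2)) z := by
  have hs : √(p ^ 2 * z ^ 2 + q ^ 2) = q * √(1 + (p / q * z) ^ 2) := by
    rw [show p ^ 2 * z ^ 2 + q ^ 2 = q ^ 2 * (1 + (p / q * z) ^ 2) by field_simp; ring,
      sqrt_mul (sq_nonneg q), sqrt_sq hq.le]
  have h0 : 0 < √(1 + (p / q * z) ^ 2) := sqrt_pos.2 (by positivity)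
  refine (((hasDerivAt_id z).const_mul (p / q)).arsinh.div_const p).congr_deriv ?_
  rw [hs]
  simp only [id, smul_eq_mul]
  field_simp

theorem hasDerivAt_neg_arsinh_mul_inv_div {p q z : ℝ} (hp : 0 < p) (hq : 0 < q) (hz : 0 < z) :
    HasDerivAt (fun z ↦ -(arsinh (q / p * z⁻¹) / q)) (1 / (z * √(p ^ 2 * z ^ 2 + q ^ 2))) z := by
  have hs : √(p ^ 2 * z ^ 2 + q ^ 2) = p * z * √(1 + (q / p * z⁻¹) ^ 2) := by
    rw [show p ^ 2 * z ^ 2 + q ^ 2 = (p * z) ^ 2 * (1 + (q / p * z⁻¹) ^ 2) by field_simp,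
      sqrt_mul (sq_nonneg _), sqrt_sq (by positivity)]
  have h0 : 0 < √(1 + (q / p * z⁻¹) ^ 2) := sqrt_pos.2 (by positivity)
  refine (((hasDerivAt_inv hz.ne').const_mul (q / p)).arsinh.div_const q).fun_neg.congr_deriv ?_
  rw [hs]
  simp only [smul_eq_mul]
  field_simp

/-- Equation (6.3): the archimedean local density for the orbifold
`(ℙ¹, ½V(ax² + by²))`. -/
theorem sigma_infty_binary_form (a b : ℝ) (ha : 0 < a) (hb : 0 < b) :
    ∫ z : ℝ, 1 / (max |z| 1 * Real.sqrt (a * z ^ 2 + b))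
      = 2 * (arsinh (Real.sqrt (a / b)) / Real.sqrt a +
          arsinh (Real.sqrt (b / a)) / Real.sqrt b) := by
  obtain ⟨p, hp, rfl⟩ : ∃ p : ℝ, 0 < p ∧ a = p ^ 2 := ⟨√a, sqrt_pos.2 ha, (sq_sqrt ha.le).symm⟩
  obtain ⟨q, hq, rfl⟩ : ∃ q : ℝ, 0 < q ∧ b = q ^ 2 := ⟨√b, sqrt_pos.2 hb, (sq_sqrt hb.le).symm⟩
  rw [← div_pow, ← div_pow, sqrt_sq hp.le, sqrt_sq hq.le, sqrt_sq (by positivity),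
    sqrt_sq (by positivity)]
  have hcont : Continuous fun z : ℝ ↦ 1 / √(p ^ 2 * z ^ 2 + q ^ 2) :=
    continuous_const.div (by fun_prop) fun z ↦ (sqrt_pos.2 (by positivity)).ne'
  have hIoc : EqOn (fun z : ℝ ↦ 1 / (max z 1 * √(p ^ 2 * z ^ 2 + q ^ 2)))
      (fun z ↦ 1 / √(p ^ 2 * z ^ 2 + q ^ 2)) (Ioc 0 1) := fun z hz ↦ by
    simp [max_eq_right hz.2]
  have hIoi : EqOn (fun z : ℝ ↦ 1 / (max z 1 * √(p ^ 2 * z ^ 2 + q ^ 2)))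
      (fun z ↦ 1 / (z * √(p ^ 2 * z ^ 2 + q ^ 2))) (Ioi 1) := fun z hz ↦ by
    simp [max_eq_left (le_of_lt (mem_Ioi.1 hz))]
  have hderiv : ∀ z ∈ Ici (1 : ℝ), HasDerivAt (fun z ↦ -(arsinh (q / p * z⁻¹) / q))
      (1 / (z * √(p ^ 2 * z ^ 2 + q ^ 2))) z := fun z hz ↦
    hasDerivAt_neg_arsinh_mul_inv_div hp hq (zero_lt_one.trans_le hz)
  have hnonneg : ∀ z ∈ Ioi (1 : ℝ), 0 ≤ 1 / (z * √(p ^ 2 * z ^ 2 + q ^ 2)) := fun z hz ↦ by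
    have : 0 < z := zero_lt_one.trans hz
    positivity
  have hlim : Tendsto (fun z ↦ -(arsinh (q / p * z⁻¹) / q)) atTop (𝓝 0) := by
    simpa using (((tendsto_inv_atTop_zero (𝕜 := ℝ)).const_mul (q / p)).arsinh.div_const q).neg
  have h₁ : ∫ z in Ioc (0 : ℝ) 1, 1 / √(p ^ 2 * z ^ 2 + q ^ 2) = arsinh (p / q) / p := by
    rw [← intervalIntegral.integral_of_le zero_le_one,
      intervalIntegral.integral_eq_sub_of_hasDerivAt
        (fun z _ ↦ hasDerivAt_arsinh_mul_div hp hq z) (hcont.intervalIntegrable _ _)]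
    simp
  have h₂ : ∫ z in Ioi (1 : ℝ), 1 / (z * √(p ^ 2 * z ^ 2 + q ^ 2)) = arsinh (q / p) / q := by
    rw [integral_Ioi_of_hasDerivAt_of_nonneg' hderiv hnonneg hlim]
    simp
  have habs := integral_comp_abs (f := fun z : ℝ ↦ 1 / (max z 1 * √(p ^ 2 * z ^ 2 + q ^ 2)))
  simp only [sq_abs] at habs
  rw [habs, ← Ioc_union_Ioi_eq_Ioi zero_le_one,
    setIntegral_union (Ioc_disjoint_Ioi le_rfl) measurableSet_Ioi
      ((integrableOn_congr_fun hIoc measurableSet_Ioc).2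
        (hcont.integrableOn_Ioc))
      ((integrableOn_congr_fun hIoi measurableSet_Ioi).2
        (integrableOn_Ioi_deriv_of_nonneg' hderiv hnonneg hlim)),
    setIntegral_congr_fun measurableSet_Ioc hIoc, setIntegral_congr_fun measurableSet_Ioi hIoi,
    h₁, h₂]
end

section
/- Let a and b be nonzero coprime integers with ab squarefree, let x and y be coprime integers, and let u, v be integers with v squarefree, such that ax² + by² = u²v³ and ax² + by² ≠ 0. Then gcd(a, v) = 1 and gcd(b, v) = 1 (so that abv is squarefree). If moreover a > 0 and b > 0, then v > 0. -/
/-- If `a` is squarefree, `a` and `b` are coprime and `x` and `y` are coprime, then `a` is coprime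
to every `v` whose square divides `a * x ^ 2 + b * y ^ 2`. -/
theorem isCoprime_of_sq_dvd_binary_form {a b x y v : ℤ} (ha : Squarefree a)
    (hab : IsCoprime a b) (hxy : IsCoprime x y) (h : v ^ 2 ∣ a * x ^ 2 + b * y ^ 2) :
    IsCoprime a v := by
  refine isCoprime_of_prime_dvd (fun h0 => ha.ne_zero h0.1) fun p hp hpa hpv => ?_
  have hpp : p ^ 2 ∣ a * x ^ 2 + b * y ^ 2 := (pow_dvd_pow_of_dvd hpv 2).trans h
  have hpb : ¬ p ∣ b := fun hpb => hp.not_isUnit (hab.isUnit_of_dvd' hpa hpb)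
  have hpby : p ∣ b * y ^ 2 :=
    (dvd_add_right (hpa.mul_right _)).1 ((dvd_pow_self p two_ne_zero).trans hpp)
  have hpy : p ∣ y := hp.dvd_of_dvd_pow ((hp.dvd_or_dvd hpby).resolve_left hpb)
  have hpax : p ^ 2 ∣ a * x ^ 2 :=
    (dvd_add_left ((pow_dvd_pow_of_dvd hpy 2).mul_left b)).1 hpp
  have hpx : IsCoprime (p ^ 2) (x ^ 2) := (IsCoprime.of_isCoprime_of_dvd_left hxy.symm hpy).pow
  exact hp.not_isUnit (ha p (sq p ▸ hpx.dvd_of_dvd_mul_right hpax))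


/-- The opening claim of Section 6.2: in the decomposition `ax² + by² = u²v³`
(with `v` squarefree) of a nonzero value of a binary quadratic form with
`gcd(x,y) = 1`, one has `gcd(a,v) = gcd(b,v) = 1` (so `abv` is squarefree),
and `v > 0` when `a, b > 0`. -/
theorem gcd_of_squareful_value (a b : ℤ) (ha : a ≠ 0) (hb : b ≠ 0)
    (hab : Int.gcd a b = 1) (hsq : Squarefree (a * b))
    (x y u v : ℤ) (hxy : Int.gcd x y = 1) (hv : Squarefree v)
    (heq : a * x ^ 2 + b * y ^ 2 = u ^ 2 * v ^ 3)
    (hne : a * x ^ 2 + b * y ^ 2 ≠ 0) :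
    Int.gcd a v = 1 ∧ Int.gcd b v = 1 ∧ Squarefree (a * b * v) ∧
      (0 < a → 0 < b → 0 < v) := by
  have hvF : v ^ 2 ∣ a * x ^ 2 + b * y ^ 2 := ⟨u ^ 2 * v, by rw [heq]; ring⟩
  rw [← Int.isCoprime_iff_gcd_eq_one] at hab hxy
  have hav : IsCoprime a v :=
    isCoprime_of_sq_dvd_binary_form hsq.of_mul_left hab hxy hvF
  have hbv : IsCoprime b v :=
    isCoprime_of_sq_dvd_binary_form hsq.of_mul_right hab.symm hxy.symm (by rwa [add_comm])
  refine ⟨Int.isCoprime_iff_gcd_eq_one.1 hav, Int.isCoprime_iff_gcd_eq_one.1 hbv,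
    squarefree_mul_iff.2 ⟨(hav.mul_left hbv).isRelPrime, hsq, hv⟩, fun ha0 hb0 => ?_⟩
  have hpos : 0 < u ^ 2 * v ^ 3 := heq ▸ lt_of_le_of_ne (by positivity) hne.symm
  exact (Odd.pow_pos_iff (by decide)).1 (pos_of_mul_pos_right hpos (sq_nonneg u))
end

section
/- Let a and b be nonzero integers with ab squarefree. There exists a constant C > 0, depending only on a and b, with the following property: for every integer v such that abv is squarefree, if there exist integers (x₁, x₂, x₃) with a·x₁² + b·x₂² = v³·x₃² and gcd(x₁, x₂) = 1, then there exist integers (x₁, x₂, x₃) with a·x₁² + b·x₂² = v³·x₃², gcd(x₁, x₂) = 1, and max(|x₁|, |x₂|, |x₃|) ≤ C·|v|⁷. -/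
/-- A form `A s² + 2 B s t + C t²` whose negated determinant is not a square is anisotropic. -/
theorem binary_form_anisotropic {A B C : ℤ} (hD : ¬ IsSquare (-(A * C - B ^ 2))) {s t : ℤ}
    (h : A * s ^ 2 + 2 * B * s * t + C * t ^ 2 = 0) : s = 0 ∧ t = 0 := by
  have hA : A ≠ 0 := by
    rintro rfl
    exact hD ⟨B, by ring⟩
  have ht : t = 0 := by
    by_contra ht
    have h1 : (A * s + B * t) ^ 2 = t ^ 2 * (-(A * C - B ^ 2)) := by
      linear_combination A * h
    have h2 : t ∣ A * s + B * t := by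
      rw [← Int.pow_dvd_pow_iff two_ne_zero]
      exact ⟨_, h1⟩
    obtain ⟨k, hk⟩ := h2
    apply hD
    refine ⟨k, ?_⟩
    apply mul_left_cancel₀ (pow_ne_zero 2 ht)
    rw [← h1, hk]
    ring
  subst ht
  refine ⟨?_, rfl⟩
  have : A * s ^ 2 = 0 := by linear_combination h
  simpa [hA] using this

/-- Gauss reduction of binary quadratic forms of determinant `D`, with `-D` not a square. -/
theorem exists_reduced_binary_form {D : ℤ} (hD : ¬ IsSquare (-D)) (A B C : ℤ)
    (h : A * C - B ^ 2 = D) :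
    ∃ p q r u : ℤ, p * u - q * r = 1 ∧
      |A * p ^ 2 + 2 * B * p * r + C * r ^ 2| ≤ 2 * |D| ∧
      |A * p * q + B * (p * u + q * r) + C * r * u| ≤ 2 * |D| ∧
      |A * q ^ 2 + 2 * B * q * u + C * u ^ 2| ≤ 2 * |D| := by
  induction hn : A.natAbs using Nat.strong_induction_on generalizing A B C with
  | _ n ih =>
    have hA : A ≠ 0 := by
      rintro rfl
      exact hD ⟨B, by rw [← h]; ring⟩
    obtain ⟨k, hk⟩ : ∃ k : ℤ, 2 * |B + k * A| ≤ |A| := by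
      have h1 : |B.bmod A.natAbs| * 2 ≤ |A| := by
        have hpos : 0 < A.natAbs := Int.natAbs_pos.mpr hA
        have h1 := Int.le_bmod (x := B) hpos
        have h2 := Int.bmod_le (x := B) hpos
        have h3 := abs_cases (B.bmod A.natAbs)
        rw [Int.abs_eq_natAbs A]
        omega
      have h2 : (A.natAbs : ℤ) ∣ B.bmod A.natAbs - B := Int.dvd_bmod_sub_self
      obtain ⟨c, hc⟩ := (Int.natAbs_dvd.mp h2)
      refine ⟨c, ?_⟩
      have : B + c * A = B.bmod A.natAbs := by linear_combination -hc
      rw [this]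
      linarith
    set B' := B + k * A with hB'
    set C' := A * k ^ 2 + 2 * B * k + C with hC'
    have hdet : A * C' - B' ^ 2 = D := by rw [← h, hB', hC']; ring
    by_cases hlt : |C'| < |A|
    · obtain ⟨p, q, r, u, hdt, h1, h2, h3⟩ := ih C'.natAbs (by rw [← hn]; rwa [Int.abs_eq_natAbs, Int.abs_eq_natAbs, Int.ofNat_lt] at hlt) C' (-B') A
        (by linear_combination hdet) rfl
      refine ⟨k * p - r, k * q - u, p, q, by linear_combination hdt, ?_, ?_, ?_⟩
      · convert h1 using 2
        rw [hB', hC']; ring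
      · convert h2 using 2
        rw [hB', hC']; ring
      · convert h3 using 2
        rw [hB', hC']; ring
    · push Not at hlt
      have hA1 : 1 ≤ |A| := Int.one_le_abs hA
      have hAC : |A| * |C'| ≤ |D| + |B'| ^ 2 := by
        rw [← abs_mul, ← abs_pow]
        have : A * C' = D + B' ^ 2 := by linear_combination hdet
        rw [this]
        exact abs_add_le _ _
      have hB0 := abs_nonneg B'
      have hAA : |A| * |A| ≤ |A| * |C'| := by gcongr
      have hBB : 4 * |B'| ^ 2 ≤ |A| * |A| := by nlinarith
      have hCC : |C'| ≤ |A| * |C'| := by nlinarith [abs_nonneg C']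
      refine ⟨1, k, 0, 1, by ring, ?_, ?_, ?_⟩
      · have : A * 1 ^ 2 + 2 * B * 1 * 0 + C * 0 ^ 2 = A := by ring
        rw [this]
        nlinarith
      · have : A * 1 * k + B * (1 * 1 + k * 0) + C * 0 * 1 = B' := by rw [hB']; ring
        rw [this]
        nlinarith
      · have : A * k ^ 2 + 2 * B * k * 1 + C * 1 ^ 2 = C' := by rw [hC']; ring
        rw [this]
        nlinarith

/-- An integer dividing `c m` and `c n` with `m`, `n` coprime divides `c`. -/
theorem IsCoprime.dvd_of_dvd_mul_mul {m n c d : ℤ} (h : IsCoprime m n) (hm : d ∣ c * m)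
    (hn : d ∣ c * n) : d ∣ c := by
  obtain ⟨i, j, hij⟩ := h
  have : c = i * (c * m) + j * (c * n) := by linear_combination -c * hij
  rw [this]
  exact dvd_add (hm.mul_left _) (hn.mul_left _)

/-- The content of the reflection of an isotropic vector divides a constant. -/
theorem reflection_content_dvd {A B C s₀ t₀ w₀ s₁ t₁ w₁ m n κ : ℤ}
    (h₁ : A * s₁ ^ 2 + 2 * B * s₁ * t₁ + C * t₁ ^ 2 = w₁ ^ 2)
    (hc₁ : IsCoprime s₁ t₁) (hmn : IsCoprime m n)
    (hw : (A * m ^ 2 + 2 * B * m * n + C * n ^ 2) * w₁ = κ * w₀)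
    (hs : (A * m ^ 2 + 2 * B * m * n + C * n ^ 2) * s₁
      - 2 * (A * m * s₁ + B * (m * t₁ + n * s₁) + C * n * t₁) * m = κ * s₀)
    (ht : (A * m ^ 2 + 2 * B * m * n + C * n ^ 2) * t₁
      - 2 * (A * m * s₁ + B * (m * t₁ + n * s₁) + C * n * t₁) * n = κ * t₀) :
    κ ∣ 2 * w₁ ^ 3 * (A * C - B ^ 2) := by
  set Q := A * m ^ 2 + 2 * B * m * n + C * n ^ 2 with hQ
  set β := A * m * s₁ + B * (m * t₁ + n * s₁) + C * n * t₁ with hβ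
  have dQ : κ ∣ w₁ * Q := ⟨w₀, by linear_combination hw⟩
  have dβ : κ ∣ 2 * w₁ * β := by
    apply hmn.dvd_of_dvd_mul_mul
    · exact ⟨w₀ * s₁ - w₁ * s₀, by linear_combination s₁ * hw - w₁ * hs⟩
    · exact ⟨w₀ * t₁ - w₁ * t₀, by linear_combination t₁ * hw - w₁ * ht⟩
  obtain ⟨p, q, hpq⟩ := hc₁
  obtain ⟨i, j, hij⟩ := hmn
  obtain ⟨α, hα⟩ : ∃ α, α = p * m + q * n := ⟨_, rfl⟩
  obtain ⟨γ, hγ⟩ : ∃ γ, γ = s₁ * n - t₁ * m := ⟨_, rfl⟩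
  have hm : m = α * s₁ - γ * q := by rw [hα, hγ]; linear_combination -m * hpq
  have hn : n = α * t₁ + γ * p := by rw [hα, hγ]; linear_combination -n * hpq
  have hαγ : IsCoprime α γ :=
    ⟨i * s₁ + j * t₁, j * p - i * q, by linear_combination hij - i * hm - j * hn⟩
  obtain ⟨b, hb⟩ : ∃ b, b = -A * s₁ * q + B * (s₁ * p - t₁ * q) + C * t₁ * p := ⟨_, rfl⟩
  obtain ⟨c, hc⟩ : ∃ c, c = A * q ^ 2 - 2 * B * p * q + C * p ^ 2 := ⟨_, rfl⟩
  have hβ' : β = α * w₁ ^ 2 + γ * b := by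
    rw [hβ, hm, hn, hb, ← h₁]; ring
  have hQ' : Q = α * β + γ * (α * b + γ * c) := by
    rw [hβ', hQ, hm, hn, hb, hc, ← h₁]; ring
  have hdet : w₁ ^ 2 * c - b ^ 2 = A * C - B ^ 2 := by
    have : w₁ ^ 2 * c - b ^ 2 = (A * C - B ^ 2) * (p * s₁ + q * t₁) ^ 2 := by
      rw [hb, hc, ← h₁]; ring
    rw [this, hpq]; ring
  rw [← hdet]
  obtain ⟨x, hx⟩ := dQ
  obtain ⟨y, hy⟩ := dβ
  have d1 : κ ∣ 2 * w₁ * γ * (w₁ ^ 2 * c - b ^ 2) := by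
    apply hαγ.symm.dvd_of_dvd_mul_mul
    · refine ⟨w₁ ^ 2 * (2 * x - α * y) - γ * b * y, ?_⟩
      linear_combination 2 * w₁ ^ 2 * hx - 2 * w₁ ^ 3 * hQ' - w₁ ^ 2 * α * hy - γ * b * hy
        + 2 * w₁ * b * γ * hβ'
    · refine ⟨γ * c * y - b * (2 * x - α * y), ?_⟩
      linear_combination γ * c * hy - 2 * b * hx + b * α * hy + 2 * b * w₁ * hQ'
        - 2 * w₁ * γ * c * hβ'
  obtain ⟨z, hz⟩ := d1
  apply hαγ.dvd_of_dvd_mul_mul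
  · refine ⟨(w₁ ^ 2 * c - b ^ 2) * y - b * z, ?_⟩
    linear_combination (w₁ ^ 2 * c - b ^ 2) * hy - b * hz
      - 2 * w₁ * (w₁ ^ 2 * c - b ^ 2) * hβ'
  · exact ⟨w₁ ^ 2 * z, by linear_combination w₁ ^ 2 * hz⟩

/-- If an anisotropic binary form represents a square primitively, then in every residue class
modulo `v` of such a representation there is one of a square which is `O(v²)`. -/
theorem exists_small_square_value {A B C : ℤ} (hD : ¬ IsSquare (-(A * C - B ^ 2))) :
    ∃ K : ℤ, ∀ s₀ t₀ w₀ : ℤ, IsCoprime s₀ t₀ →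
      A * s₀ ^ 2 + 2 * B * s₀ * t₀ + C * t₀ ^ 2 = w₀ ^ 2 → ∀ v : ℤ, v ≠ 0 →
      ∃ s t w : ℤ, A * s ^ 2 + 2 * B * s * t + C * t ^ 2 = w ^ 2 ∧ w ≠ 0 ∧
        v ∣ s - s₀ ∧ v ∣ t - t₀ ∧ |w| ≤ K * v ^ 2 := by
  have key : ∀ {s t w : ℤ}, IsCoprime s t →
      A * s ^ 2 + 2 * B * s * t + C * t ^ 2 = w ^ 2 → w ≠ 0 := by
    rintro s t w hst h rfl
    obtain ⟨rfl, rfl⟩ := binary_form_anisotropic hD (by simpa using h)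
    exact not_isCoprime_zero_zero hst
  by_cases hex : ∃ s₁ t₁ w₁ : ℤ, IsCoprime s₁ t₁ ∧
      A * s₁ ^ 2 + 2 * B * s₁ * t₁ + C * t₁ ^ 2 = w₁ ^ 2
  swap
  · exact ⟨0, fun s t w h1 h2 => (hex ⟨s, t, w, h1, h2⟩).elim⟩
  obtain ⟨s₁, t₁, w₁, hc₁, h₁⟩ := hex
  have hw₁ := key hc₁ h₁
  set k := 2 * w₁ ^ 3 * (A * C - B ^ 2) with hk
  have hk0 : k ≠ 0 := by
    have : A * C - B ^ 2 ≠ 0 := fun h0 => hD (by rw [h0]; exact ⟨0, by ring⟩)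
    exact mul_ne_zero (by positivity) this
  refine ⟨(|A| + 2 * |B| + |C|) * k ^ 2 * |w₁| + |w₁|, ?_⟩
  intro s₀ t₀ w₀ hc₀ h₀ v hv
  have hw₀ := key hc₀ h₀
  have hv1 : 1 ≤ v ^ 2 := by
    have : 0 < v ^ 2 := by positivity
    linarith
  have hS : 0 ≤ (|A| + 2 * |B| + |C|) * k ^ 2 * |w₁| := by positivity
  have hw₁' := abs_nonneg w₁
  by_cases hM : w₁ * s₀ - w₀ * s₁ = 0 ∧ w₁ * t₀ - w₀ * t₁ = 0
  · refine ⟨s₀, t₀, w₀, h₀, hw₀, by simp, by simp, ?_⟩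
    have hdvd : w₀ ∣ w₁ := hc₀.dvd_of_dvd_mul_mul ⟨s₁, by linear_combination hM.1⟩
      ⟨t₁, by linear_combination hM.2⟩
    have : |w₀| ≤ |w₁| := Int.le_of_dvd (abs_pos.mpr hw₁) ((abs_dvd_abs _ _).mpr hdvd)
    nlinarith
  obtain ⟨g, m, n, hg, hmn, hgm, hgn⟩ : ∃ g m n : ℤ, g ≠ 0 ∧ IsCoprime m n ∧
      w₁ * s₀ - w₀ * s₁ = g * m ∧ w₁ * t₀ - w₀ * t₁ = g * n := by
    have hpos : 0 < Int.gcd (w₁ * s₀ - w₀ * s₁) (w₁ * t₀ - w₀ * t₁) := by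
      rw [Nat.pos_iff_ne_zero, Ne, Int.gcd_eq_zero_iff]
      exact hM
    obtain ⟨g, m, n, hg, hmn, h1, h2⟩ := Int.exists_gcd_one' hpos
    exact ⟨g, m, n, by positivity, Int.isCoprime_iff_gcd_eq_one.mpr hmn,
      by rw [h1]; ring, by rw [h2]; ring⟩
  set Q := A * m ^ 2 + 2 * B * m * n + C * n ^ 2 with hQ
  set β := A * m * s₁ + B * (m * t₁ + n * s₁) + C * n * t₁ with hβ
  obtain ⟨δ, hδ⟩ : ∃ δ, δ = A * s₀ * s₁ + B * (s₀ * t₁ + t₀ * s₁) + C * t₀ * t₁ - w₀ * w₁ :=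
    ⟨_, rfl⟩
  have hgQ : g ^ 2 * Q = -2 * w₀ * w₁ * δ := by
    have : g ^ 2 * Q = A * (g * m) ^ 2 + 2 * B * (g * m) * (g * n) + C * (g * n) ^ 2 := by
      rw [hQ]; ring
    rw [this, ← hgm, ← hgn, hδ]
    linear_combination w₁ ^ 2 * h₀ + w₀ ^ 2 * h₁
  have hgβ : g * β = w₁ * δ := by
    have : g * β = A * (g * m) * s₁ + B * ((g * m) * t₁ + (g * n) * s₁) + C * (g * n) * t₁ := by
      rw [hβ]; ring
    rw [this, ← hgm, ← hgn, hδ]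
    linear_combination -w₀ * h₁
  have hs' : g ^ 2 * (Q * s₁ - 2 * β * m) = -2 * w₁ ^ 2 * δ * s₀ := by
    linear_combination s₁ * hgQ - 2 * g * m * hgβ + 2 * w₁ * δ * hgm
  have ht' : g ^ 2 * (Q * t₁ - 2 * β * n) = -2 * w₁ ^ 2 * δ * t₀ := by
    linear_combination t₁ * hgQ - 2 * g * n * hgβ + 2 * w₁ * δ * hgn
  obtain ⟨κ, hκ⟩ : g ^ 2 ∣ -2 * w₁ ^ 2 * δ :=
    hc₀.dvd_of_dvd_mul_mul ⟨_, hs'.symm⟩ ⟨_, ht'.symm⟩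
  have hg2 : g ^ 2 ≠ 0 := pow_ne_zero 2 hg
  have hw : Q * w₁ = κ * w₀ :=
    mul_left_cancel₀ hg2 (by linear_combination w₁ * hgQ + w₀ * hκ)
  have hs : Q * s₁ - 2 * β * m = κ * s₀ :=
    mul_left_cancel₀ hg2 (by linear_combination hs' + s₀ * hκ)
  have ht : Q * t₁ - 2 * β * n = κ * t₀ :=
    mul_left_cancel₀ hg2 (by linear_combination ht' + t₀ * hκ)
  obtain ⟨l, hl⟩ : κ ∣ k := reflection_content_dvd h₁ hc₁ hmn hw hs ht
  have hκ0 : κ ≠ 0 := by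
    rintro rfl
    exact hk0 (by rw [hl]; ring)
  have hN : v * k ≠ 0 := mul_ne_zero hv hk0
  set m' := m % (v * k) with hm'
  set n' := n % (v * k) with hn'
  obtain ⟨i, hi⟩ : ∃ i, m' = m + κ * l * v * i :=
    ⟨-(m / (v * k)), by rw [← hl]; linear_combination Int.emod_add_mul_ediv m (v * k)⟩
  obtain ⟨j, hj⟩ : ∃ j, n' = n + κ * l * v * j :=
    ⟨-(n / (v * k)), by rw [← hl]; linear_combination Int.emod_add_mul_ediv n (v * k)⟩
  have hQ'0 : A * m' ^ 2 + 2 * B * m' * n' + C * n' ^ 2 ≠ 0 := by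
    intro h0
    obtain ⟨h1, h2⟩ := binary_form_anisotropic hD h0
    have hu := hmn.isUnit_of_dvd' (Int.dvd_of_emod_eq_zero h1) (Int.dvd_of_emod_eq_zero h2)
    have h2u : IsUnit (2 : ℤ) :=
      isUnit_of_dvd_unit ⟨v * (w₁ ^ 3 * (A * C - B ^ 2)), by rw [hk]; ring⟩ hu
    exact absurd h2u (by decide)
  set Q' := A * m' ^ 2 + 2 * B * m' * n' + C * n' ^ 2 with hQ'
  set β' := A * m' * s₁ + B * (m' * t₁ + n' * s₁) + C * n' * t₁ with hβ'
  obtain ⟨x, hx⟩ : ∃ x, Q' = Q + κ * l * v * x := by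
    refine ⟨A * (2 * m + κ * l * v * i) * i
      + 2 * B * (m * j + n * i + κ * l * v * i * j) + C * (2 * n + κ * l * v * j) * j, ?_⟩
    rw [hQ', hQ, hi, hj]; ring
  obtain ⟨y, hy⟩ : ∃ y, β' = β + κ * l * v * y := by
    refine ⟨A * i * s₁ + B * (i * t₁ + j * s₁) + C * j * t₁, ?_⟩
    rw [hβ', hβ, hi, hj]; ring
  obtain ⟨z, hz⟩ : ∃ z, Q' * s₁ - 2 * β' * m' = κ * (s₀ + v * z) := by
    refine ⟨l * (x * s₁ - 2 * (y * m + β * i + κ * l * v * y * i)), ?_⟩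
    rw [hx, hy, hi]
    linear_combination hs
  obtain ⟨z', hz'⟩ : ∃ z, Q' * t₁ - 2 * β' * n' = κ * (t₀ + v * z) := by
    refine ⟨l * (x * t₁ - 2 * (y * n + β * j + κ * l * v * y * j)), ?_⟩
    rw [hx, hy, hj]
    linear_combination ht
  have hw' : Q' * w₁ = κ * (w₀ + v * (l * x * w₁)) := by
    rw [hx]; linear_combination hw
  refine ⟨s₀ + v * z, t₀ + v * z', w₀ + v * (l * x * w₁), ?_, ?_, by simp, by simp, ?_⟩
  · apply mul_left_cancel₀ (pow_ne_zero 2 hκ0)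
    have e1 : κ ^ 2 * (A * (s₀ + v * z) ^ 2 + 2 * B * (s₀ + v * z) * (t₀ + v * z')
        + C * (t₀ + v * z') ^ 2) = A * (κ * (s₀ + v * z)) ^ 2
        + 2 * B * (κ * (s₀ + v * z)) * (κ * (t₀ + v * z')) + C * (κ * (t₀ + v * z')) ^ 2 := by
      ring
    have e2 : κ ^ 2 * (w₀ + v * (l * x * w₁)) ^ 2 = (κ * (w₀ + v * (l * x * w₁))) ^ 2 := by ring
    rw [e1, e2, ← hz, ← hz', ← hw', hβ']
    linear_combination Q' ^ 2 * h₁ - 4 * β' ^ 2 * hQ'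
  · intro h0
    rw [h0, mul_zero] at hw'
    exact mul_ne_zero hQ'0 hw₁ hw'
  · have hm1 : |m'| ≤ |v * k| := by
      rw [abs_of_nonneg (Int.emod_nonneg _ hN)]
      exact (Int.emod_lt_abs _ hN).le
    have hn1 : |n'| ≤ |v * k| := by
      rw [abs_of_nonneg (Int.emod_nonneg _ hN)]
      exact (Int.emod_lt_abs _ hN).le
    have hQb : |Q'| ≤ (|A| + 2 * |B| + |C|) * (k ^ 2 * v ^ 2) := by
      calc |Q'| ≤ |A * m' ^ 2| + |2 * B * m' * n'| + |C * n' ^ 2| := abs_add_three _ _ _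
        _ = |A| * (|m'| * |m'|) + 2 * |B| * (|m'| * |n'|) + |C| * (|n'| * |n'|) := by
          simp only [abs_mul, abs_pow, abs_two]; ring
        _ ≤ |A| * (|v * k| * |v * k|) + 2 * |B| * (|v * k| * |v * k|)
            + |C| * (|v * k| * |v * k|) := by gcongr
        _ = (|A| + 2 * |B| + |C|) * (k ^ 2 * v ^ 2) := by
          rw [abs_mul_abs_self]; ring
    have hκ1 : 1 ≤ |κ| := Int.one_le_abs hκ0
    calc |w₀ + v * (l * x * w₁)| ≤ |κ| * |w₀ + v * (l * x * w₁)| :=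
          le_mul_of_one_le_left (abs_nonneg _) hκ1
      _ = |Q'| * |w₁| := by rw [← abs_mul, ← hw', abs_mul]
      _ ≤ (|A| + 2 * |B| + |C|) * (k ^ 2 * v ^ 2) * |w₁| := by gcongr
      _ ≤ _ := by linarith [mul_nonneg hw₁' (sq_nonneg v)]

/-- Up to automorphs of `a x² + b y²`, a primitive vector is bounded by its value. -/
theorem exists_automorph_small {a b : ℤ} (ha : a ≠ 0) (hb : b ≠ 0) (hsq : ¬ IsSquare (-(a * b))) :
    ∃ K : ℤ, 0 ≤ K ∧ ∀ x y : ℤ, IsCoprime x y → ∃ x' y' : ℤ, IsCoprime x' y' ∧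
      a * x' ^ 2 + b * y' ^ 2 = a * x ^ 2 + b * y ^ 2 ∧
      x' ^ 2 + y' ^ 2 ≤ K * |a * x ^ 2 + b * y ^ 2| := by
  have ha1 : 1 ≤ |a| := Int.one_le_abs ha
  have hb1 : 1 ≤ |b| := Int.one_le_abs hb
  have hle : ∀ x y : ℤ, x ^ 2 + y ^ 2 ≤ |a| * x ^ 2 + |b| * y ^ 2 := fun x y => by
    nlinarith [sq_nonneg x, sq_nonneg y]
  rcases lt_or_ge 0 (a * b) with hab | hab
  · refine ⟨1, zero_le_one, fun x y hxy => ⟨x, y, hxy, rfl, ?_⟩⟩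
    have : |a * x ^ 2 + b * y ^ 2| = |a| * x ^ 2 + |b| * y ^ 2 := by
      rcases pos_and_pos_or_neg_and_neg_of_mul_pos hab with ⟨h1, h2⟩ | ⟨h1, h2⟩
      · rw [abs_of_pos h1, abs_of_pos h2, abs_of_nonneg (by positivity)]
      · rw [abs_of_neg h1, abs_of_neg h2, abs_of_nonpos]
        · ring
        · nlinarith [sq_nonneg x, sq_nonneg y]
    rw [this, one_mul]
    exact hle x y
  · have hab' : a * b < 0 := lt_of_le_of_ne hab (mul_ne_zero ha hb)
    obtain ⟨T, U, hTU, hU⟩ := Pell.exists_of_not_isSquare (d := -(a * b)) (by linarith) hsq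
    have hT : T ≠ 0 := by
      rintro rfl
      nlinarith [sq_nonneg U]
    refine ⟨|T|, abs_nonneg T, fun x y hxy => ?_⟩
    induction hn : x.natAbs using Nat.strong_induction_on generalizing x y with
    | _ n ih =>
      have hmove : ∀ V : ℤ, V ^ 2 = U ^ 2 → (T * x - b * V * y).natAbs < n →
          ∃ x' y' : ℤ, IsCoprime x' y' ∧
            a * x' ^ 2 + b * y' ^ 2 = a * x ^ 2 + b * y ^ 2 ∧
            x' ^ 2 + y' ^ 2 ≤ |T| * |a * x ^ 2 + b * y ^ 2| := by
        intro V hV hlt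
        have hTV : T ^ 2 + a * b * V ^ 2 = 1 := by rw [hV]; linear_combination hTU
        have hf : a * (T * x - b * V * y) ^ 2 + b * (a * V * x + T * y) ^ 2
            = a * x ^ 2 + b * y ^ 2 := by
          linear_combination (a * x ^ 2 + b * y ^ 2) * hTV
        obtain ⟨i, j, hij⟩ := hxy
        have hcop : IsCoprime (T * x - b * V * y) (a * V * x + T * y) :=
          ⟨i * T - j * a * V, i * b * V + j * T, by
            linear_combination (i * x + j * y) * hTV + hij⟩
        obtain ⟨x', y', h1, h2, h3⟩ := ih _ hlt _ _ hcop rfl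
        rw [hf] at h2 h3
        exact ⟨x', y', h1, h2, h3⟩
      by_cases h1 : (T * x - b * U * y).natAbs < n
      · exact hmove U rfl h1
      by_cases h2 : (T * x - b * (-U) * y).natAbs < n
      · exact hmove (-U) (by ring) h2
      refine ⟨x, y, hxy, rfl, (hle x y).trans ?_⟩
      push Not at h1 h2
      rw [← hn, Int.natAbs_le_iff_sq_le] at h1 h2
      set S := |a| * x ^ 2 + |b| * y ^ 2 with hS
      have hS0 : 0 ≤ S := by positivity
      set f := a * x ^ 2 + b * y ^ 2 with hf
      have hSf : S ^ 2 - f ^ 2 = -(4 * (a * b) * (x * y) ^ 2) := by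
        have e : |a| * |b| = -(a * b) := by rw [← abs_mul, abs_of_neg hab']
        rw [hS, hf]
        linear_combination x ^ 4 * sq_abs a + y ^ 4 * sq_abs b + 2 * x ^ 2 * y ^ 2 * e
      have hbS : b * (b * y ^ 2 - a * x ^ 2) = |b| * S := by
        have e : |a| * |b| = -(a * b) := by rw [← abs_mul, abs_of_neg hab']
        rw [hS]
        linear_combination -(y ^ 2) * sq_abs b - x ^ 2 * e
      have hP1 : 2 * (T * b * U * (x * y)) ≤ U ^ 2 * (|b| * S) := by
        rw [← hbS]
        nlinarith [mul_comm (x ^ 2) (T ^ 2 - -(a * b) * U ^ 2)]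
      have hP2 : -(U ^ 2 * (|b| * S)) ≤ 2 * (T * b * U * (x * y)) := by
        rw [← hbS]
        nlinarith [mul_comm (x ^ 2) (T ^ 2 - -(a * b) * U ^ 2)]
      have hsqle : (2 * (T * b * U * (x * y))) ^ 2 ≤ (U ^ 2 * (|b| * S)) ^ 2 :=
        sq_le_sq' hP2 hP1
      have hsq2 : 4 * T ^ 2 * (x * y) ^ 2 ≤ U ^ 2 * S ^ 2 := by
        have hpos : 0 < b ^ 2 * U ^ 2 := by positivity
        refine le_of_mul_le_mul_left ?_ hpos
        calc b ^ 2 * U ^ 2 * (4 * T ^ 2 * (x * y) ^ 2)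
            = (2 * (T * b * U * (x * y))) ^ 2 := by ring
          _ ≤ (U ^ 2 * (|b| * S)) ^ 2 := hsqle
          _ = b ^ 2 * U ^ 2 * (U ^ 2 * S ^ 2) := by
            rw [mul_pow, mul_pow, sq_abs]; ring
      have hfin : S ^ 2 ≤ (|T| * |f|) ^ 2 := by
        rw [mul_pow, sq_abs, sq_abs]
        have h3 := mul_le_mul_of_nonneg_left hsq2 (by linarith : 0 ≤ -(a * b))
        have h4 : T ^ 2 * S ^ 2 - T ^ 2 * f ^ 2 ≤ (T ^ 2 - 1) * S ^ 2 := by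
          calc T ^ 2 * S ^ 2 - T ^ 2 * f ^ 2 = -(a * b) * (4 * T ^ 2 * (x * y) ^ 2) := by
                linear_combination T ^ 2 * hSf
            _ ≤ -(a * b) * (U ^ 2 * S ^ 2) := h3
            _ = (T ^ 2 - 1) * S ^ 2 := by linear_combination -S ^ 2 * hTU
        linarith
      exact le_of_sq_le_sq hfin (by positivity)

/-- Solutions with `x₃ = O(v²)`. -/
theorem exists_coprime_solution_small_third {a b : ℤ} (hsq : ¬ IsSquare (-(a * b))) :
    ∃ K : ℤ, 0 ≤ K ∧ ∀ v : ℤ, v ≠ 0 → ∀ x₀ y₀ w₀ : ℤ,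
      a * x₀ ^ 2 + b * y₀ ^ 2 = v ^ 3 * w₀ ^ 2 → IsCoprime x₀ y₀ →
      ∃ x y w : ℤ, a * x ^ 2 + b * y ^ 2 = v ^ 3 * w ^ 2 ∧ IsCoprime x y ∧
        |w| ≤ K * v ^ 2 := by
  have hK : ∀ A B C : ℤ, ∃ K : ℤ, A * C - B ^ 2 = a * b → ∀ s₀ t₀ w₀ : ℤ, IsCoprime s₀ t₀ →
      A * s₀ ^ 2 + 2 * B * s₀ * t₀ + C * t₀ ^ 2 = w₀ ^ 2 → ∀ v : ℤ, v ≠ 0 →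
      ∃ s t w : ℤ, A * s ^ 2 + 2 * B * s * t + C * t ^ 2 = w ^ 2 ∧ w ≠ 0 ∧
        v ∣ s - s₀ ∧ v ∣ t - t₀ ∧ |w| ≤ K * v ^ 2 := by
    intro A B C
    by_cases h : A * C - B ^ 2 = a * b
    · obtain ⟨K, hK⟩ := exists_small_square_value (A := A) (B := B) (C := C) (by rwa [h])
      exact ⟨K, fun _ => hK⟩
    · exact ⟨0, fun h' => (h h').elim⟩
  choose K hK using hK
  set R := 2 * |a * b| with hR
  set I := Finset.Icc (-R) R with hI
  refine ⟨∑ P ∈ I ×ˢ I ×ˢ I, |K P.1 P.2.1 P.2.2|, by positivity, ?_⟩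
  intro v hv x₀ y₀ w₀ h₀ hc₀
  obtain ⟨i, j, hij⟩ := hc₀
  obtain ⟨B, hB⟩ : ∃ B, B = -a * x₀ * j + b * y₀ * i := ⟨_, rfl⟩
  obtain ⟨C, hC⟩ : ∃ C, C = v ^ 3 * (a * j ^ 2 + b * i ^ 2) := ⟨_, rfl⟩
  have hdet : w₀ ^ 2 * C - B ^ 2 = a * b := by
    rw [hC, hB]
    linear_combination -(a * j ^ 2 + b * i ^ 2) * h₀ + a * b * (i * x₀ + j * y₀ + 1) * hij
  obtain ⟨p, q, r, u, hpu, hA', hB', hC'⟩ := exists_reduced_binary_form hsq _ _ _ hdet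
  set A' := w₀ ^ 2 * p ^ 2 + 2 * B * p * r + C * r ^ 2 with hA'd
  set B' := w₀ ^ 2 * p * q + B * (p * u + q * r) + C * r * u with hB'd
  set C' := w₀ ^ 2 * q ^ 2 + 2 * B * q * u + C * u ^ 2 with hC'd
  have hdet' : A' * C' - B' ^ 2 = a * b := by
    rw [hA'd, hB'd, hC'd, ← hdet]
    linear_combination (w₀ ^ 2 * C - B ^ 2) * (p * u - q * r + 1) * hpu
  have hrep : A' * u ^ 2 + 2 * B' * u * (-r) + C' * (-r) ^ 2 = w₀ ^ 2 := by
    rw [hA'd, hB'd, hC'd]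
    linear_combination w₀ ^ 2 * (p * u - q * r + 1) * hpu
  obtain ⟨s, t, w, hw, hw0, hs, ht, hwb⟩ := hK A' B' C' hdet' u (-r) w₀
    ⟨p, q, by linear_combination hpu⟩ hrep v hv
  obtain ⟨s', hs'⟩ := hs
  obtain ⟨t', ht'⟩ := ht
  obtain ⟨σ, hσ⟩ : ∃ σ, σ = p * s + q * t := ⟨_, rfl⟩
  obtain ⟨τ, hτ⟩ : ∃ τ, τ = r * s + u * t := ⟨_, rfl⟩
  obtain ⟨x, hx⟩ : ∃ x, x = σ * x₀ - τ * v ^ 3 * j := ⟨_, rfl⟩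
  obtain ⟨y, hy⟩ : ∃ y, y = σ * y₀ + τ * v ^ 3 * i := ⟨_, rfl⟩
  have hxy : a * x ^ 2 + b * y ^ 2 = v ^ 3 * w ^ 2 := by
    rw [← hw, hA'd, hB'd, hC'd, hx, hy, hσ, hτ, hB, hC]
    linear_combination (p * s + q * t) ^ 2 * h₀
  have hxv : ∃ c, x = x₀ + v * c := by
    refine ⟨(p * s' + q * t') * x₀ - τ * v ^ 2 * j, ?_⟩
    rw [hx, hσ]
    linear_combination x₀ * p * hs' + x₀ * q * ht' + x₀ * hpu
  have hyv : ∃ c, y = y₀ + v * c := by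
    refine ⟨(p * s' + q * t') * y₀ + τ * v ^ 2 * i, ?_⟩
    rw [hy, hσ]
    linear_combination y₀ * p * hs' + y₀ * q * ht' + y₀ * hpu
  have hpos : 0 < Int.gcd x y := by
    rw [Nat.pos_iff_ne_zero, Ne, Int.gcd_eq_zero_iff]
    rintro ⟨rfl, rfl⟩
    have : v ^ 3 * w ^ 2 ≠ 0 := by positivity
    exact this (by rw [← hxy]; ring)
  obtain ⟨g, x', y', hg, hcop, hxg, hyg⟩ := Int.exists_gcd_one' hpos
  have hg0 : (g : ℤ) ≠ 0 := by positivity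
  obtain ⟨c, hc⟩ := hxv
  obtain ⟨d, hd⟩ := hyv
  have hgv : IsCoprime (g : ℤ) v :=
    ⟨i * x' + j * y', -(i * c + j * d), by
      linear_combination hij - i * hxg - j * hyg + i * hc + j * hd⟩
  have hgw : (g : ℤ) ∣ w := by
    rw [← Int.pow_dvd_pow_iff two_ne_zero]
    apply (hgv.pow (m := 2) (n := 3)).dvd_of_dvd_mul_left
    rw [← hxy, hxg, hyg]
    exact ⟨a * x' ^ 2 + b * y' ^ 2, by ring⟩
  obtain ⟨w', hw'⟩ := hgw
  refine ⟨x', y', w', ?_, Int.isCoprime_iff_gcd_eq_one.mpr hcop, ?_⟩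
  · apply mul_left_cancel₀ (pow_ne_zero 2 hg0)
    rw [hxg, hyg, hw'] at hxy
    linear_combination hxy
  · have hmem : (A', B', C') ∈ I ×ˢ I ×ˢ I := by
      simp only [Finset.mem_product, hI, Finset.mem_Icc]
      exact ⟨abs_le.mp hA', abs_le.mp hB', abs_le.mp hC'⟩
    have hsum := Finset.single_le_sum (f := fun P : ℤ × ℤ × ℤ => |K P.1 P.2.1 P.2.2|)
      (fun _ _ => abs_nonneg _) hmem
    have hw'w : |w'| ≤ |w| := by
      have : w' ∣ w := ⟨g, by rw [hw']; ring⟩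
      exact Int.le_of_dvd (abs_pos.mpr hw0) ((abs_dvd_abs _ _).mpr this)
    calc |w'| ≤ |w| := hw'w
      _ ≤ K A' B' C' * v ^ 2 := hwb
      _ ≤ _ := by
        gcongr
        exact (le_abs_self _).trans hsum

/-- Lemma 6.3: a version of Cassels' theorem on small solutions of ternary
quadratic forms, respecting the coprimality condition `gcd(x₁,x₂) = 1`. -/
theorem small_coprime_solution (a b : ℤ) (ha : a ≠ 0) (hb : b ≠ 0)
    (hsq : Squarefree (a * b)) :
    ∃ C : ℝ, 0 < C ∧ ∀ v : ℤ, Squarefree (a * b * v) →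
      (∃ x : ℤ × ℤ × ℤ, a * x.1 ^ 2 + b * x.2.1 ^ 2 = v ^ 3 * x.2.2 ^ 2 ∧
        Int.gcd x.1 x.2.1 = 1) →
      ∃ x : ℤ × ℤ × ℤ, a * x.1 ^ 2 + b * x.2.1 ^ 2 = v ^ 3 * x.2.2 ^ 2 ∧
        Int.gcd x.1 x.2.1 = 1 ∧
        ((max (max |x.1| |x.2.1|) |x.2.2| : ℤ) : ℝ) ≤ C * (|v| : ℝ) ^ 7 := by
  suffices h : ∃ C : ℤ, 0 < C ∧ ∀ v : ℤ, v ≠ 0 → ∀ x₀ y₀ w₀ : ℤ,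
      a * x₀ ^ 2 + b * y₀ ^ 2 = v ^ 3 * w₀ ^ 2 → IsCoprime x₀ y₀ →
      ∃ x y w : ℤ, a * x ^ 2 + b * y ^ 2 = v ^ 3 * w ^ 2 ∧ IsCoprime x y ∧
        max (max |x| |y|) |w| ≤ C * |v| ^ 7 by
    obtain ⟨C, hC, h⟩ := h
    refine ⟨C, by exact_mod_cast hC, ?_⟩
    rintro v hv ⟨⟨x₀, y₀, w₀⟩, h₀, hc₀⟩
    have hv0 : v ≠ 0 := by
      rintro rfl
      simp at hv
    obtain ⟨x, y, w, h1, h2, h3⟩ := h v hv0 x₀ y₀ w₀ h₀ (Int.isCoprime_iff_gcd_eq_one.mpr hc₀)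
    exact ⟨(x, y, w), h1, Int.isCoprime_iff_gcd_eq_one.mp h2, by exact_mod_cast h3⟩
  by_cases hs : IsSquare (-(a * b))
  · obtain ⟨k, hk⟩ := hs
    have hku : IsUnit k := hsq k ⟨-1, by linear_combination -hk⟩
    have hab : a * b = -1 := by
      have := Int.isUnit_mul_self hku
      linarith
    have hab0 : a + b = 0 := by
      rcases Int.isUnit_iff.mp (IsUnit.of_mul_eq_one (-b) (by linear_combination -hab : a * -b = 1))
        with rfl | rfl <;> linarith
    refine ⟨1, one_pos, fun v hv _ _ _ _ _ => ⟨1, 1, 0, ?_, isCoprime_one_left, ?_⟩⟩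
    · linear_combination hab0
    · simpa using one_le_pow₀ (Int.one_le_abs hv)
  obtain ⟨K₁, hK₁, h1⟩ := exists_automorph_small ha hb hs
  obtain ⟨K₂, hK₂, h2⟩ := exists_coprime_solution_small_third hs
  refine ⟨K₁ * K₂ ^ 2 + K₂ + 1, by positivity, ?_⟩
  intro v hv x₀ y₀ w₀ h₀ hc₀
  obtain ⟨x, y, w, hxy, hc, hw⟩ := h2 v hv x₀ y₀ w₀ h₀ hc₀
  obtain ⟨x', y', hc', hxy', hb'⟩ := h1 x y hc
  have hv1 : 1 ≤ |v| := Int.one_le_abs hv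
  have hv7 : 0 ≤ |v| ^ 7 := by positivity
  have hsum : x' ^ 2 + y' ^ 2 ≤ K₁ * K₂ ^ 2 * |v| ^ 7 := by
    have e : |a * x ^ 2 + b * y ^ 2| = |v| ^ 3 * |w| ^ 2 := by rw [hxy, abs_mul, abs_pow, abs_pow]
    calc x' ^ 2 + y' ^ 2 ≤ K₁ * (|v| ^ 3 * |w| ^ 2) := by rw [← e]; exact hb'
      _ ≤ K₁ * (|v| ^ 3 * (K₂ * v ^ 2) ^ 2) := by gcongr
      _ = K₁ * K₂ ^ 2 * |v| ^ 7 := by rw [← sq_abs v]; ring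
  have habs : ∀ z : ℤ, |z| ≤ z ^ 2 := fun z => by
    rw [← sq_abs]
    exact Int.le_self_sq _
  have hK : 0 ≤ K₁ * K₂ ^ 2 := by positivity
  have hbig : K₁ * K₂ ^ 2 * |v| ^ 7 ≤ (K₁ * K₂ ^ 2 + K₂ + 1) * |v| ^ 7 := by
    gcongr
    linarith
  refine ⟨x', y', w, hxy'.trans hxy, hc', max_le (max_le ?_ ?_) ?_⟩
  · linarith [habs x', sq_nonneg y']
  · linarith [habs y', sq_nonneg x']
  · calc |w| ≤ K₂ * |v| ^ 2 := by rw [sq_abs]; exact hw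
      _ ≤ K₂ * |v| ^ 7 := by gcongr; norm_num
      _ ≤ _ := by
        gcongr
        linarith
end

section
/- Let a, b, v, t₁₁, t₁₂, t₂₁, t₂₂, t₃₂, s, t be integers with gcd(s, t) = 1. Define L = (2a·t₁₁·t₁₂ + 2b·t₂₁·t₂₂)·s − 2v³·t₃₂·t and g = (a·t₁₁² + b·t₂₁²)·s² − v³·t². Then for every prime p, if p divides s·L and p divides g, then p divides t·L. -/
/-- The divisibility claim from Section 6.2: every prime dividing
`q₁ = sL(s,t)` and `q₂ = −g(s,t)` also divides `q₃ = tL(s,t)`. -/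
theorem prime_dvd_q3_of_dvd_q1_q2
    (a b v t11 t12 t21 t22 t32 s t : ℤ) (hst : Int.gcd s t = 1) :
    ∀ p : ℕ, p.Prime →
      (p : ℤ) ∣ s * ((2 * a * t11 * t12 + 2 * b * t21 * t22) * s - 2 * v ^ 3 * t32 * t) →
      (p : ℤ) ∣ (a * t11 ^ 2 + b * t21 ^ 2) * s ^ 2 - v ^ 3 * t ^ 2 →
      (p : ℤ) ∣ t * ((2 * a * t11 * t12 + 2 * b * t21 * t22) * s - 2 * v ^ 3 * t32 * t) := by
  intro p hp hq1 hq2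
  have hp' : Prime (p : ℤ) := Nat.prime_iff_prime_int.mp hp
  refine Dvd.dvd.mul_left ?_ t
  rcases hp'.dvd_or_dvd hq1 with hs | hL
  · have ht : ¬ (p : ℤ) ∣ t := fun ht =>
      hp'.not_isUnit ((Int.isCoprime_iff_gcd_eq_one.mpr hst).isUnit_of_dvd' hs ht)
    have hvt : (p : ℤ) ∣ v ^ 3 * t ^ 2 :=
      (dvd_sub_right ((hs.trans (dvd_pow_self s two_ne_zero)).mul_left _)).mp hq2
    have hv : (p : ℤ) ∣ v ^ 3 :=
      (hp'.dvd_or_dvd hvt).resolve_right fun h => ht (hp'.dvd_of_dvd_pow h)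
    exact dvd_sub (hs.mul_left _) (((hv.mul_left 2).mul_right t32).mul_right t)
  · exact hL
end

section
/- Let a, b, v be positive odd squarefree pairwise coprime integers with a ≡ b ≡ 1 (mod 4) and v ≡ 3 (mod 4). Then ρ(a,b,v) = 0. -/
/-- `ρ(a,b,v) = ∏_{odd p ∣ a}(1 + (bv/p)) ∏_{odd p ∣ b}(1 + (av/p))
∏_{odd p ∣ v}(1 + (−ab/p))`, the symbols being Legendre symbols. -/
def rho (a b v : ℕ) : ℤ :=
  (∏ p ∈ a.primeFactors.filter (· ≠ 2), (1 + jacobiSym ((b : ℤ) * v) p)) *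
  (∏ p ∈ b.primeFactors.filter (· ≠ 2), (1 + jacobiSym ((a : ℤ) * v) p)) *
  (∏ p ∈ v.primeFactors.filter (· ≠ 2), (1 + jacobiSym (-((a : ℤ) * b)) p))

/-- If `n` is odd and coprime to `m`, and no odd prime `p ∣ n` has `(m/p) = -1`, then the Jacobi
symbol `(m/n)` equals `1`. -/
theorem jacobiSym_eq_one_of_prod_one_add_ne_zero {m : ℤ} {n : ℕ} (hn : Odd n)
    (hmn : m.gcd n = 1)
    (h : ∏ p ∈ n.primeFactors.filter (· ≠ 2), (1 + jacobiSym m p) ≠ 0) :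
    jacobiSym m n = 1 := by
  refine (jacobiSym.eq_one_or_neg_one hmn).resolve_right fun hneg => h ?_
  obtain ⟨p, hp, hpn, hmp⟩ := jacobiSym.eq_neg_one_at_prime_divisor_of_eq_neg_one hneg
  refine Finset.prod_eq_zero (i := p) ?_ (by simp [hmp])
  refine Finset.mem_filter.mpr ⟨Nat.mem_primeFactors.mpr ⟨hp, hpn, hn.pos.ne'⟩, ?_⟩
  rintro rfl
  exact Nat.not_even_iff_odd.mpr hn (even_iff_two_dvd.mpr hpn)

/-- If `a ≡ b ≡ 1 (mod 4)` and `v ≡ 3 (mod 4)` then `ρ(a,b,v) = 0`. -/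
theorem rho_eq_zero_of_v_three_mod_four (a b v : ℕ)
    (ha : 0 < a) (hb : 0 < b) (hv : 0 < v)
    (hoa : Odd a) (hob : Odd b) (hov : Odd v)
    (hsa : Squarefree a) (hsb : Squarefree b) (hsv : Squarefree v)
    (hab : Nat.Coprime a b) (hav : Nat.Coprime a v) (hbv : Nat.Coprime b v)
    (ha4 : a % 4 = 1) (hb4 : b % 4 = 1) (hv4 : v % 4 = 3) :
    rho a b v = 0 := by
  by_contra h
  obtain ⟨h₁₂, h₃⟩ := mul_ne_zero_iff.mp h
  obtain ⟨h₁, h₂⟩ := mul_ne_zero_iff.mp h₁₂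
  have h_a := jacobiSym_eq_one_of_prod_one_add_ne_zero hoa
    (by exact_mod_cast Nat.Coprime.mul_left hab.symm hav.symm) h₁
  have h_b := jacobiSym_eq_one_of_prod_one_add_ne_zero hob
    (by exact_mod_cast Nat.Coprime.mul_left hab hbv.symm) h₂
  have h_v := jacobiSym_eq_one_of_prod_one_add_ne_zero hov
    (by rw [Int.neg_gcd]; exact_mod_cast Nat.Coprime.mul_left hav hbv) h₃
  rw [jacobiSym.mul_left, jacobiSym.quadratic_reciprocity_one_mod_four' hov ha4] at h_a
  rw [jacobiSym.mul_left, jacobiSym.quadratic_reciprocity_one_mod_four ha4 hob,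
    jacobiSym.quadratic_reciprocity_one_mod_four' hov hb4] at h_b
  rw [jacobiSym.neg _ hov, ZMod.χ₄_nat_three_mod_four hv4, jacobiSym.mul_left] at h_v
  have h_sq : jacobiSym b a ^ 2 = 1 := jacobiSym.sq_one (by exact_mod_cast hab.symm)
  have h_prod : jacobiSym b a ^ 2 * (jacobiSym a v * jacobiSym b v) = 1 := by
    linear_combination h_a * (jacobiSym b a * jacobiSym b v) + h_b
  rw [h_sq] at h_prod
  linarith
end

section
/- Let a and b be positive odd coprime squarefree integers. Then Σ_v (γ(v)/v^{3/2}) · ∏_{p ∣ v}(1 + (−ab/p)) · ∏_{p ∣ a}(1 + (bv/p)) · ∏_{p ∣ b}(1 + (av/p)) = Σ_{k ∣ a} Σ_{l ∣ b} (b/k)·(a/l) · ∏_{p ∤ 2ab} ( 1 + (p/kl)·(1 + (−ab/p)) / ((1 + p^{−1})·p^{3/2}) ), where the outer sum on the left is over positive squarefree integers v coprime to 2ab (and is absolutely convergent), the products over p ∣ v, p ∣ a, p ∣ b involve Legendre symbols modulo the (odd) prime p, the sums on the right are over positive divisors k of a and l of b, (b/k), (a/l) and (p/kl) denote Jacobi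 symbols, and the product over primes p not dividing 2ab converges. -/
/-- `γ(d) = ∏_{p ∣ d, p odd prime} (1 + 1/p)⁻¹`. -/
noncomputable def gammaF (d : ℕ) : ℝ :=
  ∏ p ∈ d.primeFactors.filter (· ≠ 2), (1 + (p : ℝ)⁻¹)⁻¹

open Finset in
theorem jacobiSym_prod_left {ι : Type*} (s : Finset ι) (x : ι → ℤ) (n : ℕ) :
    jacobiSym (∏ i ∈ s, x i) n = ∏ i ∈ s, jacobiSym (x i) n := by
  classical
  induction s using Finset.induction_on with
  | empty => simp [jacobiSym.one_left]
  | insert i s hi ih => rw [prod_insert hi, prod_insert hi, jacobiSym.mul_left, ih]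

theorem abs_jacobiSym_le_one (x : ℤ) (n : ℕ) : |(jacobiSym x n : ℝ)| ≤ 1 := by
  rcases jacobiSym.trichotomy x n with h | h | h <;> simp [h]

/-- The Jacobi symbol `(x/n)` as an arithmetic function of `n`. -/
def jacobiArith (x : ℤ) : ArithmeticFunction ℤ :=
  ⟨fun n => if n = 0 then 0 else jacobiSym x n, if_pos rfl⟩

theorem jacobiArith_apply (x : ℤ) {n : ℕ} (hn : n ≠ 0) : jacobiArith x n = jacobiSym x n :=
  if_neg hn

theorem jacobiArith_isMultiplicative (x : ℤ) : (jacobiArith x).IsMultiplicative := by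
  refine ArithmeticFunction.IsMultiplicative.iff_ne_zero.2 ⟨?_, fun {m n} hm hn _ => ?_⟩
  · rw [jacobiArith_apply x one_ne_zero, jacobiSym.one_right]
  · rw [jacobiArith_apply x (mul_ne_zero hm hn), jacobiArith_apply x hm, jacobiArith_apply x hn,
      jacobiSym.mul_right' x hm hn]

theorem prod_one_add_jacobiSym_eq_sum_divisors (x : ℤ) {n : ℕ} (hn : Squarefree n) :
    ∏ p ∈ n.primeFactors, (1 + jacobiSym x p) = ∑ d ∈ n.divisors, jacobiSym x d := by
  calc ∏ p ∈ n.primeFactors, (1 + jacobiSym x p)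
      = ∏ p ∈ n.primeFactors, (1 + jacobiArith x p) := Finset.prod_congr rfl fun p hp => by
        rw [jacobiArith_apply x (Nat.prime_of_mem_primeFactors hp).ne_zero]
    _ = ∑ d ∈ n.divisors, jacobiArith x d :=
        (jacobiArith_isMultiplicative x).prodPrimeFactors_one_add_of_squarefree hn
    _ = ∑ d ∈ n.divisors, jacobiSym x d := Finset.sum_congr rfl fun d hd => by
        rw [jacobiArith_apply x (Nat.pos_of_mem_divisors hd).ne']

/-- The function supported on squarefree `v` coprime to `N`, with value `∏_{p ∣ v} c p` there. -/
noncomputable def squarefreeCoprimeProd (N : ℕ) (c : ℕ → ℝ) (v : ℕ) : ℝ :=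
  open Classical in if Squarefree v ∧ v.Coprime N then ∏ p ∈ v.primeFactors, c p else 0

/-- The Euler product of a function supported on squarefree integers coprime to `N`. -/
theorem hasSum_squarefreeCoprimeProd (N : ℕ) (c : ℕ → ℝ)
    (hc : Summable fun p : {p : Nat.Primes // ¬ (p : ℕ) ∣ N} => ‖c p.1‖) :
    HasSum (squarefreeCoprimeProd N c)
      (∏' p : {p : Nat.Primes // ¬ (p : ℕ) ∣ N}, (1 + c p.1)) := by
  classical
  let ι : {p : Nat.Primes // ¬ (p : ℕ) ∣ N} ↪ ℕ :=
    (Function.Embedding.subtype _).trans (Function.Embedding.subtype _)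
  let φ : Finset {p : Nat.Primes // ¬ (p : ℕ) ∣ N} → ℕ := fun s => ∏ q ∈ s.map ι, q
  have hprime : ∀ s, ∀ q ∈ Finset.map ι s, q.Prime := by
    intro s q hq
    obtain ⟨p, -, rfl⟩ := Finset.mem_map.1 hq
    exact p.1.2
  have hφ : ∀ s, (φ s).primeFactors = s.map ι := fun s => Nat.primeFactors_prod (hprime s)
  have hinj : Function.Injective φ := fun s t h =>
    Finset.map_injective ι (by rw [← hφ, ← hφ, h])
  have hsupp : ∀ v ∉ Set.range φ, squarefreeCoprimeProd N c v = 0 := by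
    intro v hv
    refine if_neg fun ⟨hsq, hcop⟩ => hv ?_
    have hmem : ∀ q ∈ v.primeFactors, ∃ p, ι p = q := fun q hq =>
      ⟨⟨⟨q, Nat.prime_of_mem_primeFactors hq⟩, fun hd =>
        (Nat.prime_of_mem_primeFactors hq).one_lt.ne'
          (Nat.eq_one_of_dvd_coprimes hcop (Nat.dvd_of_mem_primeFactors hq) hd)⟩, rfl⟩
    refine ⟨v.primeFactors.preimage ι ι.injective.injOn, ?_⟩
    have : (v.primeFactors.preimage ι ι.injective.injOn).map ι = v.primeFactors := by
      ext q
      simp only [Finset.mem_map, Finset.mem_preimage]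
      constructor
      · rintro ⟨p, hp, rfl⟩
        exact hp
      · intro hq
        obtain ⟨p, rfl⟩ := hmem q hq
        exact ⟨p, hq, rfl⟩
    simp only [φ, this]
    exact Nat.prod_primeFactors_of_squarefree hsq
  rw [← hinj.hasSum_iff hsupp]
  have hcomp : squarefreeCoprimeProd N c ∘ φ = fun s => ∏ p ∈ s, c p.1 := by
    funext s
    have hcop : (φ s).Coprime N := Nat.Coprime.prod_left fun q hq => by
      obtain ⟨p, -, rfl⟩ := Finset.mem_map.1 hq
      exact (Nat.Prime.coprime_iff_not_dvd p.1.2).2 p.2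
    have hsq : Squarefree (φ s) := by
      refine Finset.squarefree_prod_of_pairwise_isCoprime ?_ fun q hq => (hprime s q hq).squarefree
      intro p hp q hq hpq
      exact Nat.coprime_iff_isRelPrime.1
        ((Nat.coprime_primes (hprime s p hp) (hprime s q hq)).2 hpq)
    simp only [Function.comp, squarefreeCoprimeProd]
    rw [if_pos ⟨hsq, hcop⟩, hφ, Finset.prod_map]
    rfl
  rw [hcomp]
  have hs := summable_finsetProd_of_summable_norm hc
  rw [tprod_one_add hs]
  exact hs.hasSum

/-- The coefficient at `p` of the Euler factor attached to the modulus `m`. -/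
noncomputable def eulerCoeff (x : ℤ) (m p : ℕ) : ℝ :=
  (jacobiSym (p : ℤ) m : ℝ) * (1 + (jacobiSym x p : ℝ)) /
    ((1 + (p : ℝ)⁻¹) * (p : ℝ) ^ ((3 : ℝ) / 2))

theorem summable_norm_eulerCoeff (x : ℤ) (m : ℕ) :
    Summable fun p : Nat.Primes => ‖eulerCoeff x m p‖ := by
  have hsum : Summable fun p : Nat.Primes => 2 * (p : ℝ) ^ (-((3 : ℝ) / 2)) :=
    (Nat.Primes.summable_rpow.2 (by norm_num)).mul_left 2
  refine hsum.of_nonneg_of_le (fun _ => norm_nonneg _) fun p => ?_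
  have hp : (0 : ℝ) < (p : ℕ) := by exact_mod_cast p.2.pos
  have hpow : (0 : ℝ) < (p : ℝ) ^ ((3 : ℝ) / 2) := Real.rpow_pos_of_pos hp _
  have hinv : (0 : ℝ) < ((p : ℕ) : ℝ)⁻¹ := inv_pos.2 hp
  rw [Real.rpow_neg hp.le, ← div_eq_mul_inv, eulerCoeff, norm_div]
  refine div_le_div₀ zero_le_two ?_ hpow ?_
  · rw [norm_mul, Real.norm_eq_abs, Real.norm_eq_abs]
    have h1 := abs_jacobiSym_le_one (p : ℕ) m
    have h2 : |1 + (jacobiSym x p : ℝ)| ≤ 2 := by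
      have := abs_le.1 (abs_jacobiSym_le_one x p)
      exact abs_le.2 ⟨by linarith, by linarith⟩
    calc _ ≤ 1 * (2 : ℝ) := mul_le_mul h1 h2 (abs_nonneg _) zero_le_one
      _ = 2 := one_mul 2
  · rw [Real.norm_of_nonneg (by positivity)]
    exact le_mul_of_one_le_left hpow.le (by linarith)

theorem prod_eulerCoeff (x : ℤ) (m : ℕ) {v : ℕ} (hv : Squarefree v) (hodd : ¬ 2 ∣ v) :
    ∏ p ∈ v.primeFactors, eulerCoeff x m p =
      gammaF v / (v : ℝ) ^ ((3 : ℝ) / 2) *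
        ((∏ p ∈ v.primeFactors, (1 + jacobiSym x p) : ℤ) : ℝ) * (jacobiSym (v : ℤ) m : ℝ) := by
  have hgamma : gammaF v = ∏ p ∈ v.primeFactors, (1 + (p : ℝ)⁻¹)⁻¹ := by
    rw [gammaF, Finset.filter_true_of_mem]
    rintro p hp rfl
    exact hodd (Nat.dvd_of_mem_primeFactors hp)
  have hprod := Nat.prod_primeFactors_of_squarefree hv
  have hpow : (v : ℝ) ^ ((3 : ℝ) / 2) = ∏ p ∈ v.primeFactors, (p : ℝ) ^ ((3 : ℝ) / 2) := by
    rw [Real.finsetProd_rpow _ _ fun p _ => Nat.cast_nonneg p, ← Nat.cast_prod, hprod]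
  have hjac : jacobiSym (v : ℤ) m = ∏ p ∈ v.primeFactors, jacobiSym (p : ℤ) m := by
    rw [← jacobiSym_prod_left, ← Nat.cast_prod, hprod]
  rw [hgamma, hpow, hjac]
  push_cast
  rw [← Finset.prod_div_distrib, ← Finset.prod_mul_distrib, ← Finset.prod_mul_distrib]
  refine Finset.prod_congr rfl fun p _ => ?_
  rw [eulerCoeff, div_eq_mul_inv, mul_inv]
  ring

theorem prod_one_add_jacobiSym_mul_eq_sum {a b : ℕ} (hsa : Squarefree a) (hsb : Squarefree b)
    (v : ℕ) :
    (∏ p ∈ a.primeFactors, (1 + jacobiSym ((b : ℤ) * v) p)) *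
        (∏ p ∈ b.primeFactors, (1 + jacobiSym ((a : ℤ) * v) p)) =
      ∑ k ∈ a.divisors, ∑ l ∈ b.divisors,
        jacobiSym (b : ℤ) k * jacobiSym (a : ℤ) l * jacobiSym (v : ℤ) (k * l) := by
  rw [prod_one_add_jacobiSym_eq_sum_divisors _ hsa, prod_one_add_jacobiSym_eq_sum_divisors _ hsb,
    Finset.sum_mul_sum]
  refine Finset.sum_congr rfl fun k hk => Finset.sum_congr rfl fun l hl => ?_
  rw [jacobiSym.mul_left, jacobiSym.mul_left,
    jacobiSym.mul_right' _ (Nat.pos_of_mem_divisors hk).ne' (Nat.pos_of_mem_divisors hl).ne']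
  ring

/-- The identity (6.23)–(6.25): expanding the sum over `v` into a finite sum
of Euler products over the divisors `k ∣ a`, `l ∣ b`. -/
theorem divisor_sum_euler_product_identity (a b : ℕ)
    (ha : 0 < a) (hb : 0 < b) (hoa : Odd a) (hob : Odd b)
    (hab : Nat.Coprime a b) (hsa : Squarefree a) (hsb : Squarefree b)
    (f : ℕ → ℝ)
    (hf : ∀ v : ℕ, f v = if Squarefree v ∧ Nat.Coprime v (2 * a * b) then
        gammaF v / (v : ℝ) ^ ((3 : ℝ) / 2) *
          (((∏ p ∈ v.primeFactors, (1 + jacobiSym (-((a : ℤ) * b)) p)) *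
            (∏ p ∈ a.primeFactors, (1 + jacobiSym ((b : ℤ) * v) p)) *
            (∏ p ∈ b.primeFactors, (1 + jacobiSym ((a : ℤ) * v) p)) : ℤ) : ℝ)
      else 0)
    (g : ℕ → ℕ → {p : Nat.Primes // ¬ (p : ℕ) ∣ 2 * a * b} → ℝ)
    (hg : ∀ k l p, g k l p = 1 + (jacobiSym ((p.1 : ℕ) : ℤ) (k * l) : ℝ) *
        (1 + (jacobiSym (-((a : ℤ) * b)) (p.1 : ℕ) : ℝ)) /
        ((1 + ((p.1 : ℕ) : ℝ)⁻¹) * ((p.1 : ℕ) : ℝ) ^ ((3 : ℝ) / 2))) :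
    Summable f ∧
    (∀ k ∈ a.divisors, ∀ l ∈ b.divisors, Multipliable (g k l)) ∧
    ∑' v : ℕ, f v = ∑ k ∈ a.divisors, ∑ l ∈ b.divisors,
      (jacobiSym (b : ℤ) k : ℝ) * (jacobiSym (a : ℤ) l : ℝ) * ∏' p, g k l p := by
  have hsummable : ∀ m, Summable fun p : {p : Nat.Primes // ¬ (p : ℕ) ∣ 2 * a * b} =>
      ‖eulerCoeff (-((a : ℤ) * b)) m p.1‖ := fun m =>
    (summable_norm_eulerCoeff (-((a : ℤ) * b)) m).subtype _
  have hg' : ∀ k l, g k l = fun p => 1 + eulerCoeff (-((a : ℤ) * b)) (k * l) p.1 := fun k l =>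
    funext fun p => hg k l p
  have hf' : f = fun v => ∑ k ∈ a.divisors, ∑ l ∈ b.divisors,
      (jacobiSym (b : ℤ) k : ℝ) * (jacobiSym (a : ℤ) l : ℝ) *
        squarefreeCoprimeProd (2 * a * b) (eulerCoeff (-((a : ℤ) * b)) (k * l)) v := by
    funext v
    rw [hf v]
    split_ifs with hv
    · have hodd : ¬ 2 ∣ v := fun h => absurd
        (Nat.eq_one_of_dvd_coprimes hv.2 h (Dvd.intro _ (mul_assoc 2 a b).symm)) (by norm_num)
      rw [mul_assoc (∏ p ∈ v.primeFactors, (1 + jacobiSym (-((a : ℤ) * b)) p)),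
        prod_one_add_jacobiSym_mul_eq_sum hsa hsb, Int.cast_mul, ← mul_assoc, Int.cast_sum,
        Finset.mul_sum]
      refine Finset.sum_congr rfl fun k _ => ?_
      rw [Int.cast_sum, Finset.mul_sum]
      refine Finset.sum_congr rfl fun l _ => ?_
      rw [squarefreeCoprimeProd, if_pos hv, prod_eulerCoeff _ _ hv.1 hodd, Int.cast_mul,
        Int.cast_mul]
      ring
    · simp [squarefreeCoprimeProd, hv]
  have hsum : HasSum f (∑ k ∈ a.divisors, ∑ l ∈ b.divisors,
      (jacobiSym (b : ℤ) k : ℝ) * (jacobiSym (a : ℤ) l : ℝ) * ∏' p, g k l p) := by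
    rw [hf']
    refine hasSum_sum fun k _ => hasSum_sum fun l _ => ?_
    rw [hg']
    exact (hasSum_squarefreeCoprimeProd _ _ (hsummable (k * l))).mul_left _
  refine ⟨hsum.summable, fun k _ l _ => ?_, hsum.tsum_eq⟩
  rw [hg']
  exact multipliable_one_add_of_summable (hsummable (k * l))
end

section
/- Let a = 37 and b = 109 (so ab = 4033), and for each prime p ∉ {2, 37, 109} set κ(p) = (1 + (−4033/p)) / ((1 + p^{−1})·p^{3/2}), where (·/p) is the Legendre symbol. Then the three products over primes p ∉ {2, 37, 109} given by S₃ = ∏_p (1 + (4033/p)·κ(p)), S₁ = ∏_p (1 + (37/p)·κ(p)) and S₂ = ∏_p (1 + (109/p)·κ(p)) all converge, and S₃ < S₁ + S₂. -/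
/-- The Legendre symbol `(a/p)` for `p` a prime (as an element of `Nat.Primes`). -/
noncomputable def leg (p : Nat.Primes) (a : ℤ) : ℤ :=
  @legendreSym (p : ℕ) ⟨p.2⟩ a

open Finset Filter Topology

/-- The primes different from `2`, `37` and `109`. -/
abbrev AdmissiblePrime : Type :=
  {p : Nat.Primes // (p : ℕ) ≠ 2 ∧ (p : ℕ) ≠ 37 ∧ (p : ℕ) ≠ 109}

/-- The weight `(1 + (−4033/p)) / ((1 + p⁻¹) p^{3/2})`. -/
noncomputable def weight (p : AdmissiblePrime) : ℝ :=
  (1 + (leg p.1 (-4033) : ℝ)) / ((1 + ((p.1 : ℕ) : ℝ)⁻¹) * ((p.1 : ℕ) : ℝ) ^ ((3 : ℝ) / 2))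

section Products

variable {ι : Type*}

lemma one_sub_sum_abs_le_prod_one_add (s : Finset ι) (f : ι → ℝ) (h : ∑ i ∈ s, |f i| ≤ 1) :
    1 - ∑ i ∈ s, |f i| ≤ ∏ i ∈ s, (1 + f i) := by
  classical
  induction s using Finset.induction_on with
  | empty => simp
  | insert a s ha ih =>
    rw [sum_insert ha] at h ⊢
    rw [prod_insert ha]
    have h0 : 0 ≤ ∑ i ∈ s, |f i| := sum_nonneg fun i _ => abs_nonneg _
    have h1 := abs_nonneg (f a)
    have h2 := neg_abs_le (f a)
    have h3 := ih (by linarith)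
    calc 1 - (|f a| + ∑ i ∈ s, |f i|) ≤ (1 - |f a|) * (1 - ∑ i ∈ s, |f i|) := by
          nlinarith [mul_nonneg h1 h0]
      _ ≤ (1 + f a) * ∏ i ∈ s, (1 + f i) :=
          mul_le_mul (by linarith) h3 (by linarith) (by linarith)

lemma prod_one_add_le_exp_sum_abs (s : Finset ι) (f : ι → ℝ) (hf : ∀ i ∈ s, |f i| ≤ 1) :
    ∏ i ∈ s, (1 + f i) ≤ Real.exp (∑ i ∈ s, |f i|) := by
  rw [Real.exp_sum]
  refine prod_le_prod (fun i hi => ?_) fun i _ => ?_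
  · linarith [hf i hi, neg_abs_le (f i)]
  · linarith [Real.add_one_le_exp |f i|, le_abs_self (f i)]

/-- An infinite product is controlled by a partial product and a bound for the tail. -/
lemma tprod_one_add_mem_Icc {f : ι → ℝ} (F : Finset ι) {T : ℝ} (hT : T < 1)
    (hf : Multipliable fun i => 1 + f i) (hF : 0 ≤ ∏ i ∈ F, (1 + f i))
    (htail : ∀ s : Finset ι, Disjoint s F → ∑ i ∈ s, |f i| ≤ T) :
    ∏' i, (1 + f i) ∈ Set.Icc ((∏ i ∈ F, (1 + f i)) * (1 - T))
      ((∏ i ∈ F, (1 + f i)) * Real.exp T) := by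
  classical
  refine isClosed_Icc.mem_of_tendsto hf.hasProd ?_
  rw [SummationFilter.unconditional_filter]
  filter_upwards [eventually_ge_atTop F] with s hs
  have hsum := htail (s \ F) sdiff_disjoint
  rw [← prod_sdiff hs, mul_comm (∏ i ∈ s \ F, _)]
  constructor
  · refine mul_le_mul_of_nonneg_left ?_ hF
    linarith [one_sub_sum_abs_le_prod_one_add (s \ F) f (by linarith)]
  · refine mul_le_mul_of_nonneg_left ?_ hF
    refine (prod_one_add_le_exp_sum_abs _ f fun i hi => ?_).trans (Real.exp_le_exp.2 hsum)
    linarith [single_le_sum (f := fun i => |f i|) (fun i _ => abs_nonneg _) hi]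

end Products

section Tail

lemma one_div_mul_sqrt_le_sub {x : ℝ} (hx : 1 < x) :
    1 / (x * √x) ≤ 1 / √(x - 1) - 1 / √(x + 1) := by
  have ha : 0 < √(x - 1) := Real.sqrt_pos.2 (by linarith)
  have hb : 0 < √(x + 1) := Real.sqrt_pos.2 (by linarith)
  have hc : 0 < √x := Real.sqrt_pos.2 (by linarith)
  have ha2 := Real.sq_sqrt (show 0 ≤ x - 1 by linarith)
  have hb2 := Real.sq_sqrt (show 0 ≤ x + 1 by linarith)
  have hc2 := Real.sq_sqrt (show 0 ≤ x by linarith)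
  set a := √(x - 1)
  set b := √(x + 1)
  set c := √x
  have hab : a * b ≤ x := by nlinarith [sq_nonneg (a - b)]
  have hsum : a + b ≤ 2 * c := by
    refine abs_le_of_sq_le_sq' ?_ (by positivity) |>.2
    nlinarith [sq_nonneg (a - b)]
  have hdiff : 1 / a - 1 / b = 2 / (a * b * (a + b)) := by
    field_simp
    nlinarith
  rw [hdiff, div_le_div_iff₀ (by positivity) (by positivity)]
  have := mul_le_mul hab hsum (by positivity) (by linarith)
  linarith

lemma sum_Ico_two_div_le (n : ℕ) :
    ∑ m ∈ Ico 50 (50 + n), 2 / ((2 * m + 1 : ℝ) * √(2 * m + 1)) ≤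
      1 / 5 - 2 / √(2 * (50 + n : ℕ)) := by
  induction n with
  | zero =>
    have : √(100 : ℝ) = 10 := by
      rw [show (100 : ℝ) = 10 ^ 2 by norm_num]
      exact Real.sqrt_sq (by norm_num)
    norm_num [this]
  | succ n ih =>
    rw [← add_assoc, sum_Ico_succ_top (by omega)]
    have h := one_div_mul_sqrt_le_sub (x := 2 * ((50 + n : ℕ) : ℝ) + 1) (by push_cast; linarith)
    rw [show 2 * ((50 + n : ℕ) : ℝ) + 1 - 1 = 2 * (50 + n : ℕ) by ring,
      show 2 * ((50 + n : ℕ) : ℝ) + 1 + 1 = 2 * (50 + n + 1 : ℕ) by push_cast; ring] at h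
    calc _ ≤ 1 / 5 - 2 / √(2 * (50 + n : ℕ)) + 2 * (1 / ((2 * ((50 + n : ℕ) : ℝ) + 1) *
            √(2 * ((50 + n : ℕ) : ℝ) + 1))) := by
          rw [mul_one_div]
          gcongr
      _ ≤ 1 / 5 - 2 / √(2 * (50 + n : ℕ)) +
          2 * (1 / √(2 * (50 + n : ℕ)) - 1 / √(2 * (50 + n + 1 : ℕ))) := by gcongr
      _ = _ := by ring

lemma sum_two_div_le (t : Finset ℕ) (ht : ∀ m ∈ t, 50 ≤ m) :
    ∑ m ∈ t, 2 / ((2 * m + 1 : ℝ) * √(2 * m + 1)) ≤ 1 / 5 := by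
  have hsub : t ⊆ Ico 50 (50 + (t.sup id + 1)) := fun m hm => by
    have := le_sup (f := id) hm
    have := ht m hm
    simp only [id, mem_Ico] at *
    omega
  refine (sum_le_sum_of_subset_of_nonneg hsub fun m _ _ => by positivity).trans
    ((sum_Ico_two_div_le _).trans ?_)
  linarith [show 0 ≤ 2 / √(2 * (50 + (t.sup id + 1) : ℕ)) by positivity]

end Tail

section Weight

lemma abs_leg_le_one (p : Nat.Primes) (a : ℤ) : |(leg p a : ℝ)| ≤ 1 := by
  have : Fact (p : ℕ).Prime := ⟨p.2⟩
  rcases eq_or_ne (a : ZMod p) 0 with h | h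
  · simp [leg, (legendreSym.eq_zero_iff p a).2 h]
  · rcases legendreSym.eq_one_or_neg_one p h with h | h <;> simp [leg, h]

lemma AdmissiblePrime.coe_injective : Function.Injective fun p : AdmissiblePrime => (p.1 : ℕ) :=
  fun _ _ h => Subtype.ext (Subtype.ext h)

lemma rpow_three_halves {x : ℝ} (hx : 0 < x) : x ^ ((3 : ℝ) / 2) = x * √x := by
  rw [show (3 : ℝ) / 2 = 1 + 1 / 2 by norm_num, Real.rpow_add hx, Real.rpow_one,
    ← Real.sqrt_eq_rpow]

lemma weight_nonneg (p : AdmissiblePrime) : 0 ≤ weight p := by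
  have := abs_le.1 (abs_leg_le_one p.1 (-4033))
  exact div_nonneg (by linarith) (by positivity)

lemma weight_le (p : AdmissiblePrime) :
    weight p ≤ 2 / (((p.1 : ℕ) : ℝ) * √((p.1 : ℕ) : ℝ)) := by
  have h := abs_le.1 (abs_leg_le_one p.1 (-4033))
  have hp : (0 : ℝ) < ((p.1 : ℕ) : ℝ) := Nat.cast_pos.2 p.1.2.pos
  rw [weight, rpow_three_halves hp]
  refine div_le_div₀ (by norm_num) (by linarith) (by positivity) ?_
  exact le_mul_of_one_le_left (by positivity) (by linarith [inv_pos.2 hp])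

lemma abs_leg_mul_weight_le (p : AdmissiblePrime) (a : ℤ) :
    |(leg p.1 a : ℝ) * weight p| ≤ weight p := by
  rw [abs_mul, abs_of_nonneg (weight_nonneg p)]
  exact mul_le_of_le_one_left (weight_nonneg p) (abs_leg_le_one p.1 a)

lemma summable_weight : Summable weight := by
  have h := (Real.summable_one_div_nat_rpow.2 (by norm_num : (1 : ℝ) < 3 / 2)).mul_left 2
  refine Summable.of_nonneg_of_le weight_nonneg (fun p => ?_)
    (h.comp_injective AdmissiblePrime.coe_injective)
  have hp : (0 : ℝ) < ((p.1 : ℕ) : ℝ) := Nat.cast_pos.2 p.1.2.pos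
  simp only [Function.comp_apply]
  rw [mul_one_div, rpow_three_halves hp]
  exact weight_le p

lemma multipliable_one_add_leg_mul_weight (a : ℤ) :
    Multipliable fun p : AdmissiblePrime => 1 + (leg p.1 a : ℝ) * weight p :=
  Real.multipliable_one_add_of_summable
    (summable_weight.of_norm_bounded fun p => abs_leg_mul_weight_le p a)

lemma legendreSym_neg_4033_of_lt_hundred (p : ℕ) [hp : Fact p.Prime] (h : p < 100)
    (hne : p ≠ 2 ∧ p ≠ 11 ∧ p ≠ 13 ∧ p ≠ 17 ∧ p ≠ 37)
    (hne' : p ∉ ({31, 43, 47, 67, 73} : Finset ℕ)) : legendreSym p (-4033) = -1 := by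
  have hprime := hp.out
  interval_cases p <;> first
    | (exfalso; revert hprime; norm_num; done)
    | (exfalso; revert hne; norm_num; done)
    | (exfalso; revert hne'; decide)
    | norm_num

lemma sum_weight_le_of_hundred_le (s : Finset AdmissiblePrime) (hs : ∀ p ∈ s, 100 ≤ (p.1 : ℕ)) :
    ∑ p ∈ s, weight p ≤ 1 / 5 := by
  have hodd : ∀ p : AdmissiblePrime, 2 * ((p.1 : ℕ) / 2) + 1 = (p.1 : ℕ) := fun p => by
    have := p.1.2.eq_two_or_odd
    have := p.2.1
    omega
  have hinj : Set.InjOn (fun p : AdmissiblePrime => (p.1 : ℕ) / 2) s := fun p _ q _ h => by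
    refine AdmissiblePrime.coe_injective ?_
    have := hodd p
    have := hodd q
    simp only at h ⊢
    omega
  calc ∑ p ∈ s, weight p
      ≤ ∑ p ∈ s, 2 / ((2 * ((p.1 : ℕ) / 2 : ℕ) + 1 : ℝ) * √(2 * ((p.1 : ℕ) / 2 : ℕ) + 1)) := by
        refine sum_le_sum fun p _ => (weight_le p).trans_eq ?_
        have : (2 * ((p.1 : ℕ) / 2 : ℕ) + 1 : ℝ) = ((p.1 : ℕ) : ℝ) := by exact_mod_cast hodd p
        rw [this]
    _ = ∑ m ∈ s.image fun p : AdmissiblePrime => (p.1 : ℕ) / 2,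
          2 / ((2 * m + 1 : ℝ) * √(2 * m + 1)) := by
        rw [sum_image hinj]
    _ ≤ 1 / 5 := by
        refine sum_two_div_le _ fun m hm => ?_
        obtain ⟨p, hp, rfl⟩ := mem_image.1 hm
        have := hs p hp
        omega

lemma weight_le_of_thirty_one_le (p : AdmissiblePrime) (hp : 31 ≤ (p.1 : ℕ)) :
    weight p ≤ 3 / 250 := by
  have h31 : (31 : ℝ) ≤ ((p.1 : ℕ) : ℝ) := by exact_mod_cast hp
  have hsqrt : (11 / 2 : ℝ) ≤ √((p.1 : ℕ) : ℝ) := Real.le_sqrt_of_sq_le (by linarith)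
  calc weight p ≤ 2 / (((p.1 : ℕ) : ℝ) * √((p.1 : ℕ) : ℝ)) := weight_le p
    _ ≤ 2 / (31 * (11 / 2)) := by gcongr
    _ ≤ 3 / 250 := by norm_num

lemma sum_weight_le_of_lt_hundred (s : Finset AdmissiblePrime)
    (hs : ∀ p ∈ s, (p.1 : ℕ) < 100 ∧ (p.1 : ℕ) ≠ 11 ∧ (p.1 : ℕ) ≠ 13 ∧ (p.1 : ℕ) ≠ 17) :
    ∑ p ∈ s, weight p ≤ 3 / 50 := by
  set L : Finset ℕ := {31, 43, 47, 67, 73} with hL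
  have hzero : ∀ p ∈ s, weight p ≠ 0 → (p.1 : ℕ) ∈ L := fun p hp h => by
    by_contra hpL
    obtain ⟨h100, h11, h13, h17⟩ := hs p hp
    have := @legendreSym_neg_4033_of_lt_hundred p.1 ⟨p.1.2⟩ h100
      ⟨p.2.1, h11, h13, h17, p.2.2.1⟩ hpL
    exact h (by simp [weight, leg, this])
  rw [← sum_filter_of_ne hzero]
  have hcard : #(s.filter fun p => (p.1 : ℕ) ∈ L) ≤ #L :=
    card_le_card_of_injOn (fun p => (p.1 : ℕ)) (fun p hp => (mem_filter.1 hp).2)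
      AdmissiblePrime.coe_injective.injOn
  have hcard' : (#(s.filter fun p => (p.1 : ℕ) ∈ L) : ℝ) ≤ 5 := by exact_mod_cast hcard
  calc ∑ p ∈ s with (p.1 : ℕ) ∈ L, weight p
      ≤ #(s.filter fun p => (p.1 : ℕ) ∈ L) • (3 / 250 : ℝ) := by
        refine sum_le_card_nsmul _ _ _ fun p hp => weight_le_of_thirty_one_le p ?_
        have := (mem_filter.1 hp).2
        simp only [hL, mem_insert, mem_singleton] at this
        omega
    _ ≤ 3 / 50 := by
        rw [nsmul_eq_mul]
        linarith

lemma sum_weight_le (s : Finset AdmissiblePrime)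
    (hs : ∀ p ∈ s, (p.1 : ℕ) ≠ 11 ∧ (p.1 : ℕ) ≠ 13 ∧ (p.1 : ℕ) ≠ 17) :
    ∑ p ∈ s, weight p ≤ 13 / 50 := by
  rw [← sum_filter_add_sum_filter_not s fun p => (p.1 : ℕ) < 100]
  have h₁ := sum_weight_le_of_lt_hundred (s.filter fun p => (p.1 : ℕ) < 100) fun p hp =>
    ⟨(mem_filter.1 hp).2, hs p (mem_filter.1 hp).1⟩
  have h₂ := sum_weight_le_of_hundred_le (s.filter fun p => ¬ (p.1 : ℕ) < 100) fun p hp =>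
    not_lt.1 (mem_filter.1 hp).2
  linarith

/-- The admissible prime `11`. -/
def primeEleven : AdmissiblePrime := ⟨⟨11, by norm_num⟩, by decide⟩

/-- The admissible prime `13`. -/
def primeThirteen : AdmissiblePrime := ⟨⟨13, by norm_num⟩, by decide⟩

/-- The admissible prime `17`. -/
def primeSeventeen : AdmissiblePrime := ⟨⟨17, by norm_num⟩, by decide⟩

lemma prod_one_add_leg_mul_weight (a : ℤ) :
    ∏ p ∈ {primeEleven, primeThirteen, primeSeventeen}, (1 + (leg p.1 a : ℝ) * weight p) =
      (1 + (leg primeEleven.1 a : ℝ) * weight primeEleven) *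
      ((1 + (leg primeThirteen.1 a : ℝ) * weight primeThirteen) *
      (1 + (leg primeSeventeen.1 a : ℝ) * weight primeSeventeen)) := by
  rw [prod_insert (by decide), prod_insert (by decide), prod_singleton]

lemma tprod_one_add_leg_mul_weight_mem_Icc (a : ℤ) {A : ℝ}
    (hA : (1 + (leg primeEleven.1 a : ℝ) * weight primeEleven) *
      ((1 + (leg primeThirteen.1 a : ℝ) * weight primeThirteen) *
      (1 + (leg primeSeventeen.1 a : ℝ) * weight primeSeventeen)) = A) (hA0 : 0 ≤ A) :
    ∏' p : AdmissiblePrime, (1 + (leg p.1 a : ℝ) * weight p) ∈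
      Set.Icc (A * (37 / 50)) (A * (50 / 37)) := by
  rw [← prod_one_add_leg_mul_weight] at hA
  have h := tprod_one_add_mem_Icc (T := 13 / 50) {primeEleven, primeThirteen, primeSeventeen}
    (by norm_num) (multipliable_one_add_leg_mul_weight a) (hA ▸ hA0) fun s hs => by
      refine (sum_le_sum fun p _ => abs_leg_mul_weight_le p a).trans (sum_weight_le s fun p hp => ?_)
      have hmem := disjoint_left.1 hs hp
      simp only [mem_insert, mem_singleton, not_or] at hmem
      exact ⟨fun h => hmem.1 (AdmissiblePrime.coe_injective h),
        fun h => hmem.2.1 (AdmissiblePrime.coe_injective h),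
        fun h => hmem.2.2 (AdmissiblePrime.coe_injective h)⟩
  rw [hA] at h
  have hexp : Real.exp (13 / 50) ≤ 50 / 37 := by
    have := Real.add_one_le_exp (-(13 / 50 : ℝ))
    rw [Real.exp_neg] at this
    have := inv_anti₀ (by norm_num) this
    rw [inv_inv] at this
    exact this.trans (by norm_num)
  refine ⟨by linarith [h.1], h.2.trans (mul_le_mul_of_nonneg_left hexp hA0)⟩

lemma leg_primeEleven : leg primeEleven.1 (-4033) = 1 ∧ leg primeEleven.1 4033 = -1 ∧
    leg primeEleven.1 37 = 1 ∧ leg primeEleven.1 109 = -1 := by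
  have : Fact (Nat.Prime 11) := ⟨by norm_num⟩
  simp only [leg, primeEleven]
  refine ⟨?_, ?_, ?_, ?_⟩ <;> norm_num

lemma leg_primeThirteen : leg primeThirteen.1 (-4033) = 1 ∧ leg primeThirteen.1 4033 = 1 ∧
    leg primeThirteen.1 37 = -1 ∧ leg primeThirteen.1 109 = -1 := by
  have : Fact (Nat.Prime 13) := ⟨by norm_num⟩
  simp only [leg, primeThirteen]
  refine ⟨?_, ?_, ?_, ?_⟩ <;> norm_num

lemma leg_primeSeventeen : leg primeSeventeen.1 (-4033) = 1 ∧ leg primeSeventeen.1 4033 = 1 ∧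
    leg primeSeventeen.1 37 = -1 ∧ leg primeSeventeen.1 109 = -1 := by
  have : Fact (Nat.Prime 17) := ⟨by norm_num⟩
  simp only [leg, primeSeventeen]
  refine ⟨?_, ?_, ?_, ?_⟩ <;> norm_num

lemma weight_mem_Icc_of_sqrt {p : AdmissiblePrime} (hleg : leg p.1 (-4033) = 1) {u v : ℝ}
    (hu : 0 < u) (hv : 0 ≤ v) (hup : u ^ 2 ≤ ((p.1 : ℕ) : ℝ)) (hpv : ((p.1 : ℕ) : ℝ) ≤ v ^ 2) :
    weight p ∈ Set.Icc (2 / ((((p.1 : ℕ) : ℝ) + 1) * v)) (2 / ((((p.1 : ℕ) : ℝ) + 1) * u)) := by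
  have hp : (0 : ℝ) < ((p.1 : ℕ) : ℝ) := Nat.cast_pos.2 p.1.2.pos
  have hw : weight p = 2 / ((((p.1 : ℕ) : ℝ) + 1) * √((p.1 : ℕ) : ℝ)) := by
    rw [weight, rpow_three_halves hp, hleg, ← mul_assoc, add_mul, inv_mul_cancel₀ hp.ne']
    norm_num
  have h₁ : u ≤ √((p.1 : ℕ) : ℝ) := Real.le_sqrt_of_sq_le hup
  have h₂ : √((p.1 : ℕ) : ℝ) ≤ v := Real.sqrt_le_iff.2 ⟨hv, hpv⟩
  rw [hw]
  constructor <;> gcongr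

lemma weight_primeEleven_mem_Icc : weight primeEleven ∈ Set.Icc (0.05 : ℝ) 0.051 := by
  have h := weight_mem_Icc_of_sqrt leg_primeEleven.1 (u := 3.3) (v := 3.32)
    (by norm_num) (by norm_num) (by norm_num [primeEleven]) (by norm_num [primeEleven])
  refine Set.Icc_subset_Icc ?_ ?_ h <;> norm_num [primeEleven]

lemma weight_primeThirteen_mem_Icc : weight primeThirteen ∈ Set.Icc (0.039 : ℝ) 0.04 := by
  have h := weight_mem_Icc_of_sqrt leg_primeThirteen.1 (u := 3.6) (v := 3.61)
    (by norm_num) (by norm_num) (by norm_num [primeThirteen]) (by norm_num [primeThirteen])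
  refine Set.Icc_subset_Icc ?_ ?_ h <;> norm_num [primeThirteen]

lemma weight_primeSeventeen_mem_Icc : weight primeSeventeen ∈ Set.Icc (0.026 : ℝ) 0.0271 := by
  have h := weight_mem_Icc_of_sqrt leg_primeSeventeen.1 (u := 4.11) (v := 4.13)
    (by norm_num) (by norm_num) (by norm_num [primeSeventeen]) (by norm_num [primeSeventeen])
  refine Set.Icc_subset_Icc ?_ ?_ h <;> norm_num [primeSeventeen]

end Weight

/-- The core inequality of Corollary 1.5 for `a = 37`, `b = 109`:
with `κ(p) = (1 + (−4033/p))/((1 + p⁻¹) p^{3/2})`, the products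
`S₃ = ∏(1 + (4033/p)κ(p))`, `S₁ = ∏(1 + (37/p)κ(p))`,
`S₂ = ∏(1 + (109/p)κ(p))` over primes `p ∉ {2, 37, 109}` converge and
satisfy `S₃ < S₁ + S₂`. -/
theorem counterexample_inequality
    (κ : {p : Nat.Primes // (p : ℕ) ≠ 2 ∧ (p : ℕ) ≠ 37 ∧ (p : ℕ) ≠ 109} → ℝ)
    (hκ : ∀ p, κ p = (1 + (leg p.1 (-4033) : ℝ)) /
      ((1 + ((p.1 : ℕ) : ℝ)⁻¹) * ((p.1 : ℕ) : ℝ) ^ ((3 : ℝ) / 2))) :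
    Multipliable (fun p : {p : Nat.Primes // (p : ℕ) ≠ 2 ∧ (p : ℕ) ≠ 37 ∧ (p : ℕ) ≠ 109} =>
      1 + (leg p.1 4033 : ℝ) * κ p) ∧
    Multipliable (fun p : {p : Nat.Primes // (p : ℕ) ≠ 2 ∧ (p : ℕ) ≠ 37 ∧ (p : ℕ) ≠ 109} =>
      1 + (leg p.1 37 : ℝ) * κ p) ∧
    Multipliable (fun p : {p : Nat.Primes // (p : ℕ) ≠ 2 ∧ (p : ℕ) ≠ 37 ∧ (p : ℕ) ≠ 109} =>
      1 + (leg p.1 109 : ℝ) * κ p) ∧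
    (∏' p : {p : Nat.Primes // (p : ℕ) ≠ 2 ∧ (p : ℕ) ≠ 37 ∧ (p : ℕ) ≠ 109},
        (1 + (leg p.1 4033 : ℝ) * κ p)) <
      (∏' p : {p : Nat.Primes // (p : ℕ) ≠ 2 ∧ (p : ℕ) ≠ 37 ∧ (p : ℕ) ≠ 109},
        (1 + (leg p.1 37 : ℝ) * κ p)) +
      (∏' p : {p : Nat.Primes // (p : ℕ) ≠ 2 ∧ (p : ℕ) ≠ 37 ∧ (p : ℕ) ≠ 109},
        (1 + (leg p.1 109 : ℝ) * κ p)) := by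
  obtain rfl : κ = weight := funext hκ
  refine ⟨multipliable_one_add_leg_mul_weight _, multipliable_one_add_leg_mul_weight _,
    multipliable_one_add_leg_mul_weight _, ?_⟩
  obtain ⟨-, a₃, a₁, a₂⟩ := leg_primeEleven
  obtain ⟨-, b₃, b₁, b₂⟩ := leg_primeThirteen
  obtain ⟨-, c₃, c₁, c₂⟩ := leg_primeSeventeen
  obtain ⟨hx, hx'⟩ := weight_primeEleven_mem_Icc
  obtain ⟨hy, hy'⟩ := weight_primeThirteen_mem_Icc
  obtain ⟨hz, hz'⟩ := weight_primeSeventeen_mem_Icc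
  have h₃ := tprod_one_add_leg_mul_weight_mem_Icc 4033 rfl
  have h₁ := tprod_one_add_leg_mul_weight_mem_Icc 37 rfl
  have h₂ := tprod_one_add_leg_mul_weight_mem_Icc 109 rfl
  rw [a₃, b₃, c₃] at h₃
  rw [a₁, b₁, c₁] at h₁
  rw [a₂, b₂, c₂] at h₂
  push_cast at h₁ h₂ h₃
  generalize weight primeEleven = x at *
  generalize weight primeThirteen = y at *
  generalize weight primeSeventeen = z at *
  have k₃ : (1 + -1 * x) * ((1 + 1 * y) * (1 + 1 * z)) ≤ 0.95 * (1.04 * 1.0271) := by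
    gcongr <;> linarith
  have k₁ : 1.05 * (0.96 * 0.9729) ≤ (1 + 1 * x) * ((1 + -1 * y) * (1 + -1 * z)) := by
    gcongr <;> linarith
  have k₂ : 0.949 * (0.96 * 0.9729) ≤ (1 + -1 * x) * ((1 + -1 * y) * (1 + -1 * z)) := by
    gcongr <;> linarith
  have p₃ : 0 ≤ (1 + -1 * x) * ((1 + 1 * y) * (1 + 1 * z)) :=
    mul_nonneg (by linarith) (mul_nonneg (by linarith) (by linarith))
  have h₃' := (h₃ p₃).2
  have h₁' := (h₁ (by linarith)).1
  have h₂' := (h₂ (by linarith)).1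
  linarith
end
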